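/- Let β ∈ {1,2,4}, α > −1, δ > −2, and let n ≥ 1 be an integer (with n ≥ 3 if β = 1 and n ≥ 2 if β = 4). Define the polynomials p_0(z) = −(n/2)(βn + 2α + 2 − β)(βn + δ/2 + α − z), p_1(z) = (βn + α − δ/2)z − (βn + α + δ/2)(βn + α + δ/2 + 2 − β), and p_2(z) = −z³ + 2(βn + α − δ/2)z² − (βn + α + δ/2 + 6 − 3β)(βn + α + δ/2 + 2 − β)z + βz. Then each σ_m^{(β)} is infinitely differentiable on ℝ and σ_n^{(β)} satisfies, for all z ∈ ℝ, the ODE: η^{(β)} z³ σ_n'''' + 6 η^{(β)} z³ (σ_n'')² + β(2z² σ_n''' + z(σ_n')² + 4z² σ_n' σ_n'') + p_2(z) σ_n'' + p_1(z) σ_n' + p_0(z) = (12 b_n^{(β)}/β) · z³ · exp(σ_{n−i(β)}(z) + σ_{n+i(β)}(z) − 2σ_n(z)). -/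

import Mathlib

open MeasureTheory Filter Finset

/-- The β-deformed Vandermonde interaction factor `∏_{j<k} |T_k - T_j|^β`. -/
noncomputable def vand (β : ℝ) {n : ℕ} (T : Fin n → ℝ) : ℝ :=
  ∏ j, ∏ k ∈ Finset.Ioi j, |T k - T j| ^ β

/-- The Jacobi-ensemble weight `∏_j T_j^α (1-T_j)^{δ/2} ∏_{j<k} |T_k-T_j|^β`. -/
noncomputable def jacW (β α δ : ℝ) (n : ℕ) (T : Fin n → ℝ) : ℝ :=
  (∏ j, T j ^ α * (1 - T j) ^ (δ / 2)) * vand β T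

/-- Selberg's integral `c_n^{(β)}`. -/
noncomputable def cSel (β α δ : ℝ) (n : ℕ) : ℝ :=
  ∫ T in Set.Icc (0 : Fin n → ℝ) 1, jacW β α δ n T

/-- The moment generating function `M_n^{(β)}(z)` of the conductance. -/
noncomputable def Mcond (β α δ : ℝ) (n : ℕ) (z : ℝ) : ℝ :=
  (∫ T in Set.Icc (0 : Fin n → ℝ) 1,
      Real.exp (∑ j, -(z * T j)) * jacW β α δ n T) / cSel β α δ n

/-- The cumulant generating function `σ_n^{(β)}(z) = log M_n^{(β)}(z)` of the conductance. -/
noncomputable def sigCond (β α δ : ℝ) (n : ℕ) (z : ℝ) : ℝ :=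
  Real.log (Mcond β α δ n z)

open Classical in
/-- The constant `b_n^{(β)}` built from ratios of Selberg integrals. -/
noncomputable def bcoef (β α δ : ℝ) (n : ℕ) : ℝ :=
  if β = 1 then
    ((n : ℝ) * (n - 1) / ((n + 1) * (n + 2))) *
      (cSel 1 α δ (n - 2) * cSel 1 α δ (n + 2)) / (cSel 1 α δ n) ^ 2
  else if β = 4 then
    ((n : ℝ) / (n + 1)) * (cSel 4 α δ (n - 1) * cSel 4 α δ (n + 1)) / (cSel 4 α δ n) ^ 2
  else 0

open Classical in
/-- The parameter `η^{(β)}`: 4 if β = 4, otherwise 1. -/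
noncomputable def eta (β : ℝ) : ℝ := if β = 4 then 4 else 1

open Classical in
/-- The shift `i(β)`: 1 if β = 4, otherwise 2. -/
noncomputable def ibeta (β : ℝ) : ℕ := if β = 4 then 1 else 2

theorem vand_nonneg (β : ℝ) {n : ℕ} (T : Fin n → ℝ) : 0 ≤ vand β T :=
  prod_nonneg fun _ _ => prod_nonneg fun _ _ => Real.rpow_nonneg (abs_nonneg _) _

theorem vand_eq_prod_ite (β : ℝ) {n : ℕ} (T : Fin n → ℝ) :
    vand β T = ∏ j, ∏ k, if j < k then |T k - T j| ^ β else 1 := by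
  unfold vand
  refine prod_congr rfl fun j _ => ?_
  rw [← Finset.prod_filter]
  congr 1
  ext k
  simp

/-- Splitting one point off the interaction factor. -/
theorem vand_eq_removeNth (β : ℝ) {m : ℕ} (y : Fin (m + 1) → ℝ) (k : Fin (m + 1)) :
    vand β y = vand β (k.removeNth y) * ∏ l, |k.removeNth y l - y k| ^ β := by
  simp only [vand_eq_prod_ite, Fin.prod_univ_succAbove _ k, lt_irrefl, if_false, one_mul,
    prod_mul_distrib, Fin.succAbove_lt_succAbove_iff, Fin.removeNth]
  rw [← mul_assoc, ← prod_mul_distrib, mul_comm]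
  congr 1
  refine prod_congr rfl fun l _ => ?_
  rcases lt_or_gt_of_ne (Fin.succAbove_ne k l) with h | h
  · simp [h, h.not_gt, abs_sub_comm]
  · simp [h, h.not_gt]

/-- The power sum `∑ x_i ^ k`. -/
noncomputable def psum (k : ℕ) {n : ℕ} (x : Fin n → ℝ) : ℝ := ∑ i, x i ^ k

theorem psum_removeNth (r : ℕ) {m : ℕ} (y : Fin (m + 1) → ℝ) (k : Fin (m + 1)) :
    psum r (k.removeNth y) = psum r y - y k ^ r := by
  simp [psum, Fin.sum_univ_succAbove _ k, Fin.removeNth]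

/-- The sign of a real number, as a quotient. -/
noncomputable def sg (x : ℝ) : ℝ := x / |x|

theorem sg_of_pos {x : ℝ} (h : 0 < x) : sg x = 1 := by
  rw [sg, abs_of_pos h, div_self h.ne']

theorem sg_of_neg {x : ℝ} (h : x < 0) : sg x = -1 := by
  rw [sg, abs_of_neg h, div_neg, div_self h.ne]

theorem abs_sg_le_one (x : ℝ) : |sg x| ≤ 1 := by
  rw [sg, abs_div, abs_abs]
  exact div_self_le_one _

theorem abs_mul_sg (x : ℝ) : |x| * sg x = x := by
  rcases eq_or_ne x 0 with rfl | h
  · simp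
  · have := abs_pos.2 h
    rw [sg]; field_simp

theorem measurable_sg : Measurable sg := by
  unfold sg
  fun_prop

theorem sum_prod_erase_sg (s : Finset ℝ) :
    ∑ a ∈ s, ∏ b ∈ s.erase a, sg (b - a) = if Even #s then 0 else 1 := by
  induction s using Finset.induction_on_max with
  | empty => simp
  | insert M s hM ih =>
    have hMs : M ∉ s := fun h => (hM M h).false
    rw [sum_insert hMs, erase_insert hMs, card_insert_of_notMem hMs]
    have h1 : ∏ b ∈ s, sg (b - M) = (-1) ^ #s := by
      rw [prod_congr rfl fun b hb => sg_of_neg (sub_neg.2 (hM b hb)), prod_const]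
    have h2 : ∑ a ∈ s, ∏ b ∈ (insert M s).erase a, sg (b - a)
        = ∑ a ∈ s, ∏ b ∈ s.erase a, sg (b - a) := by
      refine sum_congr rfl fun a ha => ?_
      rw [erase_insert_of_ne (hM a ha).ne', prod_insert (fun h => hMs (mem_of_mem_erase h)),
        sg_of_pos (sub_pos.2 (hM a ha)), one_mul]
    rw [h1, h2, ih]
    rcases Nat.even_or_odd #s with h | h
    · simp [h, h.neg_one_pow, Nat.even_add_one]
    · simp [Nat.not_even_iff_odd.2 h, h.neg_one_pow, Nat.even_add_one]

theorem sum_prod_sg_eq_zero {ι : Type*} [Fintype ι] [DecidableEq ι] (hι : Even (Fintype.card ι))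
    {w : ι → ℝ} (hw : Function.Injective w) :
    ∑ i, ∏ j ∈ univ.erase i, sg (w j - w i) = 0 := by
  have h := sum_prod_erase_sg (univ.map ⟨w, hw⟩)
  rw [card_map, card_univ, if_pos hι, sum_map] at h
  rw [← h]
  refine sum_congr rfl fun i _ => ?_
  rw [← map_erase, prod_map]
  rfl

theorem Fin.prod_erase_eq_succAbove {m : ℕ} (k : Fin (m + 1)) (f : Fin (m + 1) → ℝ) :
    ∏ j ∈ univ.erase k, f j = ∏ l, f (k.succAbove l) := by
  rw [Fin.univ_succAbove m k, erase_cons, prod_map]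
  rfl

/-- For an even number of distinct points, split in two groups, the alternating sum of the ranks
vanishes. -/
theorem sum_removeNth_sg_add {p q : ℕ} (hpq : Even (p + q)) (u : Fin (p + 1) → ℝ)
    (v : Fin (q + 1) → ℝ) (h : Function.Injective (Sum.elim u v)) :
    ∑ k, (∏ i, sg (k.removeNth u i - u k)) * ∏ l, sg (v l - u k)
      + ∑ k, (∏ i, sg (k.removeNth v i - v k)) * ∏ l, sg (u l - v k) = 0 := by
  have hc : Even (Fintype.card (Fin (p + 1) ⊕ Fin (q + 1))) := by
    simp only [Fintype.card_sum, Fintype.card_fin]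
    obtain ⟨r, hr⟩ := hpq
    exact ⟨r + 1, by omega⟩
  rw [← sum_prod_sg_eq_zero hc h, Fintype.sum_sum_type]
  congr 1 <;> refine sum_congr rfl fun k _ => ?_
  · have : univ.erase (Sum.inl k : Fin (p + 1) ⊕ Fin (q + 1))
        = (univ.erase k).disjSum univ := by
      ext (x | x) <;> simp
    rw [this, prod_disjSum]
    simp [Fin.prod_erase_eq_succAbove, Fin.removeNth]
  · have : univ.erase (Sum.inr k : Fin (p + 1) ⊕ Fin (q + 1))
        = univ.disjSum (univ.erase k) := by
      ext (x | x) <;> simp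
    rw [this, prod_disjSum, mul_comm]
    simp [Fin.prod_erase_eq_succAbove, Fin.removeNth]

section Interpolation

open Polynomial

/-- `A` is monic of degree `D`, with next coefficients `-a` and `b`; multiplying by `X ^ 2` makes
sense of these for `D < 2`. -/
def HasTop (A : ℝ[X]) (D : ℕ) (a b : ℝ) : Prop :=
  (X ^ 2 * A).coeff D = b ∧ (X ^ 2 * A).coeff (D + 1) = -a ∧ (X ^ 2 * A).coeff (D + 2) = 1 ∧
    ∀ j, D + 2 < j → (X ^ 2 * A).coeff j = 0

theorem hasTop_one : HasTop 1 0 0 0 := by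
  refine ⟨?_, ?_, ?_, fun j hj => ?_⟩ <;> simp only [mul_one, coeff_X_pow] <;> simp
  omega

theorem HasTop.mul_X_sub_C {A : ℝ[X]} {D : ℕ} {a b : ℝ} (h : HasTop A D a b) (c : ℝ) :
    HasTop (A * (X - C c)) (D + 1) (a + c) (b + a * c) := by
  obtain ⟨h0, h1, h2, h3⟩ := h
  have key : ∀ j, (X ^ 2 * (A * (X - C c))).coeff (j + 1)
      = (X ^ 2 * A).coeff j - (X ^ 2 * A).coeff (j + 1) * c := fun j => by
    rw [← mul_assoc, mul_sub, coeff_sub, coeff_mul_X, coeff_mul_C]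
  refine ⟨?_, ?_, ?_, fun j hj => ?_⟩
  · rw [key, h0, h1]; ring
  · rw [key, h1, h2]; ring
  · rw [key, h2, h3 _ (by omega)]; ring
  · obtain ⟨j, rfl⟩ : ∃ i, j = i + 1 := ⟨j - 1, by omega⟩
    rw [key, h3 _ (by omega), h3 _ (by omega)]; ring

theorem hasTop_prod {ι : Type*} (s : Finset ι) (x : ι → ℝ) :
    HasTop (∏ i ∈ s, (X - C (x i))) #s (∑ i ∈ s, x i)
      (((∑ i ∈ s, x i) ^ 2 - ∑ i ∈ s, x i ^ 2) / 2) := by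
  classical
  induction s using Finset.induction_on with
  | empty => simpa using hasTop_one
  | insert i s hi ih =>
    rw [prod_insert hi, sum_insert hi, sum_insert hi, card_insert_of_notMem hi, mul_comm]
    convert ih.mul_X_sub_C (x i) using 1 <;> ring

theorem hasTop_prod_sq {ι : Type*} (s : Finset ι) (x : ι → ℝ) :
    HasTop (∏ i ∈ s, (X - C (x i)) ^ 2) (2 * #s) (2 * ∑ i ∈ s, x i)
      (((2 * ∑ i ∈ s, x i) ^ 2 - 2 * ∑ i ∈ s, x i ^ 2) / 2) := by
  classical
  induction s using Finset.induction_on with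
  | empty => simpa using hasTop_one
  | insert i s hi ih =>
    rw [prod_insert hi, sum_insert hi, sum_insert hi, card_insert_of_notMem hi, mul_comm, pow_two,
      ← mul_assoc]
    convert (ih.mul_X_sub_C (x i)).mul_X_sub_C (x i) using 1 <;> ring

/-- Evaluation of a residue functional: it kills the multiples of `B` and extracts the leading
coefficient modulo `B`. -/
theorem residue_eval {L : ℝ[X] →ₗ[ℝ] ℝ} {A B : ℝ[X]} {D : ℕ} {a a' b b' : ℝ}
    (hA : HasTop A (D + 1) a a') (hB : HasTop B (D + 1) b b') (hLB : L B = 0)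
    (hLX : L (X * B) = 0) (hL : ∀ P : ℝ[X], P.degree < ((D + 1 : ℕ) : WithBot ℕ) → L P = P.coeff D) :
    L A = b - a ∧ L (X * A) = a' - b' + (b - a) * b := by
  obtain ⟨hA0, hA1, hA2, hA3⟩ := hA
  obtain ⟨hB0, hB1, hB2, hB3⟩ := hB
  have s2 : ∀ (P : ℝ[X]) j, P.coeff j = (X ^ 2 * P).coeff (j + 2) := fun P j => by
    rw [coeff_X_pow_mul]
  have s1 : ∀ (P : ℝ[X]) j, (X * P).coeff j = (X ^ 2 * P).coeff (j + 1) := fun P j => by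
    rw [pow_two, mul_assoc, coeff_X_mul]
  have e1 : L (A - B) = b - a := by
    rw [hL, coeff_sub, s2 A, s2 B, hA1, hB1]
    · ring
    · rw [degree_lt_iff_coeff_zero]
      intro j hj
      rw [coeff_sub, s2 A, s2 B]
      rcases hj.eq_or_lt with rfl | hj
      · rw [hA2, hB2, sub_self]
      · rw [hA3 _ (by omega), hB3 _ (by omega), sub_self]
  have e2 : L (X * A - X * B - C (b - a) * B) = a' - b' + (b - a) * b := by
    rw [hL, coeff_sub, coeff_sub, coeff_C_mul, s1 A, s1 B, s2 B, hA0, hB0, hB1]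
    · ring
    · rw [degree_lt_iff_coeff_zero]
      intro j hj
      rw [coeff_sub, coeff_sub, coeff_C_mul, s1 A, s1 B, s2 B]
      rcases hj.eq_or_lt with rfl | hj
      · rw [hA1, hB1, hB2]; ring
      · rcases (Nat.succ_le_of_lt hj).eq_or_lt with rfl | hj
        · rw [hA2, hB2, hB3 _ (by omega)]; ring
        · rw [hA3 _ (by omega), hB3 _ (by omega), hB3 _ (by omega)]; ring
  rw [map_sub, hLB, sub_zero] at e1
  rw [← smul_eq_C_mul, map_sub, map_sub, map_smul, hLB, hLX, smul_zero, sub_zero, sub_zero] at e2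
  exact ⟨e1, e2⟩

/-- The Lagrange functional with simple nodes. -/
noncomputable def simpleRes {m : ℕ} (y : Fin (m + 1) → ℝ) : ℝ[X] →ₗ[ℝ] ℝ where
  toFun P := ∑ k, P.eval (y k) / ∏ l, (y k - k.removeNth y l)
  map_add' P Q := by simp [add_div, sum_add_distrib]
  map_smul' c P := by simp [mul_div_assoc, mul_sum]

theorem simpleRes_eq_coeff {m : ℕ} {y : Fin (m + 1) → ℝ} (hy : Function.Injective y) (P : ℝ[X])
    (hP : P.degree < ((m + 1 : ℕ) : WithBot ℕ)) : simpleRes y P = P.coeff m := by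
  have h := Lagrange.coeff_eq_sum (s := univ) (v := y) hy.injOn (P := P) (by simpa using hP)
  simp only [card_univ, Fintype.card_fin, add_tsub_cancel_right] at h
  rw [h]
  simp [simpleRes, Fin.prod_erase_eq_succAbove, Fin.removeNth]

theorem simpleRes_mul_eq_zero {m : ℕ} (y : Fin (m + 1) → ℝ) (Q : ℝ[X]) :
    simpleRes y (Q * ∏ i, (X - C (y i))) = 0 := by
  change ∑ k : Fin (m + 1), _ = (0 : ℝ)
  refine sum_eq_zero fun k _ => ?_
  have : (∏ i, (X - C (y i))).eval (y k) = 0 := by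
    rw [eval_prod]
    exact prod_eq_zero (mem_univ k) (by simp)
  simp [this]

/-- The product of `(X - x_i) ^ 2`. -/
noncomputable def sqPoly {n : ℕ} (x : Fin n → ℝ) : ℝ[X] := ∏ i, (X - C (x i)) ^ 2

theorem sqPoly_eq_removeNth {m : ℕ} (y : Fin (m + 1) → ℝ) (k : Fin (m + 1)) :
    sqPoly y = (X - C (y k)) ^ 2 * sqPoly (k.removeNth y) := by
  simp [sqPoly, Fin.prod_univ_succAbove _ k, Fin.removeNth]

theorem eval_sqPoly {n : ℕ} (x : Fin n → ℝ) (t : ℝ) :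
    (sqPoly x).eval t = ∏ i, (x i - t) ^ 2 := by
  simp only [sqPoly, eval_prod, eval_pow, eval_sub, eval_X, eval_C]
  exact prod_congr rfl fun i _ => by ring

theorem monic_sqPoly {n : ℕ} (x : Fin n → ℝ) : (sqPoly x).Monic :=
  monic_prod_of_monic _ _ fun _ _ => (monic_X_sub_C _).pow 2

theorem natDegree_sqPoly {n : ℕ} (x : Fin n → ℝ) : (sqPoly x).natDegree = 2 * n := by
  rw [sqPoly, natDegree_prod_of_monic _ _ fun _ _ => (monic_X_sub_C _).pow 2]
  simp [mul_comm]

theorem eval_sqPoly_removeNth_ne_zero {m : ℕ} {y : Fin (m + 1) → ℝ} (hy : Function.Injective y)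
    (k : Fin (m + 1)) : (sqPoly (k.removeNth y)).eval (y k) ≠ 0 := by
  rw [eval_sqPoly, prod_ne_zero_iff]
  exact fun i _ => pow_ne_zero _ (sub_ne_zero.2 fun h => Fin.succAbove_ne k i (hy h))

/-- The functional of residues with double nodes. -/
noncomputable def doubleRes {m : ℕ} (y : Fin (m + 1) → ℝ) : ℝ[X] →ₗ[ℝ] ℝ where
  toFun P := ∑ k, ((derivative P).eval (y k) * (sqPoly (k.removeNth y)).eval (y k)
    - P.eval (y k) * (derivative (sqPoly (k.removeNth y))).eval (y k)) /
      (sqPoly (k.removeNth y)).eval (y k) ^ 2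
  map_add' P Q := by
    rw [← sum_add_distrib]
    refine sum_congr rfl fun k _ => ?_
    simp only [derivative_add, eval_add]; ring
  map_smul' c P := by
    rw [smul_eq_mul, mul_sum]
    refine sum_congr rfl fun k _ => ?_
    simp only [derivative_smul, eval_smul, smul_eq_mul, RingHom.id_apply]; ring

theorem doubleRes_mul_eq_zero {m : ℕ} (y : Fin (m + 1) → ℝ) (Q : ℝ[X]) :
    doubleRes y (Q * sqPoly y) = 0 := by
  change ∑ k : Fin (m + 1), _ = (0 : ℝ)
  refine sum_eq_zero fun k _ => ?_
  rw [sqPoly_eq_removeNth y k]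
  simp [derivative_mul, derivative_X_sub_C_sq]

theorem sq_dvd_of_eval_eq_zero {P : ℝ[X]} {c : ℝ} (h0 : P.eval c = 0)
    (h1 : (derivative P).eval c = 0) : (X - C c) ^ 2 ∣ P := by
  obtain ⟨Q, rfl⟩ := dvd_iff_isRoot.2 h0
  have : Q.eval c = 0 := by simpa [derivative_mul] using h1
  rw [pow_two]
  exact mul_dvd_mul_left _ (dvd_iff_isRoot.2 this)

theorem sqPoly_dvd {n : ℕ} {y : Fin n → ℝ} (hy : Function.Injective y) {P : ℝ[X]}
    (h0 : ∀ k, P.eval (y k) = 0) (h1 : ∀ k, (derivative P).eval (y k) = 0) : sqPoly y ∣ P :=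
  Finset.prod_dvd_of_coprime
    (fun _ _ _ _ hij => (pairwise_coprime_X_sub_C hy hij).pow)
    fun k _ => sq_dvd_of_eval_eq_zero (h0 k) (h1 k)

/-- Hermite interpolation at double nodes, leading coefficient. -/
theorem doubleRes_eq_coeff {m : ℕ} {y : Fin (m + 1) → ℝ} (hy : Function.Injective y) (P : ℝ[X])
    (hP : P.degree < ((2 * m + 1 + 1 : ℕ) : WithBot ℕ)) : doubleRes y P = P.coeff (2 * m + 1) := by
  set Q : Fin (m + 1) → ℝ[X] := fun k => sqPoly (k.removeNth y) with hQ
  have hQ0 : ∀ k, (Q k).eval (y k) ≠ 0 := eval_sqPoly_removeNth_ne_zero hy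
  set d : Fin (m + 1) → ℝ := fun k => ((derivative P).eval (y k) * (Q k).eval (y k)
    - P.eval (y k) * (derivative (Q k)).eval (y k)) / (Q k).eval (y k) ^ 2 with hd
  set e : Fin (m + 1) → ℝ := fun k => P.eval (y k) / (Q k).eval (y k) with he
  set H : ℝ[X] := ∑ k, (C (e k) + C (d k) * (X - C (y k))) * Q k with hH
  have hQd : ∀ k, (Q k).natDegree = 2 * m := fun k => natDegree_sqPoly _
  have hdeg : ∀ k, ((C (e k) + C (d k) * (X - C (y k))) * Q k).degree < ((2 * m + 1 + 1 : ℕ) : WithBot ℕ) := by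
    intro k
    refine lt_of_le_of_lt (b := ((1 + 2 * m : ℕ) : WithBot ℕ)) ?_ (by norm_cast; omega)
    refine natDegree_le_iff_degree_le.1 (natDegree_mul_le_of_le ?_ (hQd k).le)
    compute_degree
  have hcoeff : ∀ k, ((C (e k) + C (d k) * (X - C (y k))) * Q k).coeff (2 * m + 1) = d k := by
    intro k
    have h1 : (Q k).coeff (2 * m) = 1 := by
      rw [← hQd k]; exact (monic_sqPoly _).coeff_natDegree
    have h2 : (Q k).coeff (2 * m + 1) = 0 :=
      coeff_eq_zero_of_natDegree_lt (by rw [hQd]; omega)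
    have : (C (e k) + C (d k) * (X - C (y k))) * Q k
        = C (e k - d k * y k) * Q k + C (d k) * (X * Q k) := by
      simp only [map_sub, map_mul]; ring
    rw [this, coeff_add, coeff_C_mul, coeff_C_mul, coeff_X_mul, h1, h2]; ring
  have hother : ∀ j k, j ≠ k → (X - C (y k)) ^ 2 ∣ Q j := by
    intro j k hjk
    obtain ⟨i, rfl⟩ := Fin.exists_succAbove_eq hjk.symm
    exact dvd_prod_of_mem (fun i => (X - C (j.removeNth y i)) ^ 2) (mem_univ i)
  have hPH : P = H := by
    rw [← sub_eq_zero]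
    by_contra hne
    have hdvd : sqPoly y ∣ P - H := by
      have hsplit : ∀ k, ∃ S, P - H = P - (C (e k) + C (d k) * (X - C (y k))) * Q k
          + (X - C (y k)) ^ 2 * S := by
        intro k
        have : (X - C (y k)) ^ 2 ∣ ∑ j ∈ univ.erase k, (C (e j) + C (d j) * (X - C (y j))) * Q j :=
          dvd_sum fun j hj => (hother j k (ne_of_mem_erase hj)).mul_left _
        obtain ⟨S, hS⟩ := this
        refine ⟨-S, ?_⟩
        rw [hH, ← add_sum_erase _ _ (mem_univ k), hS]; ring
      refine sqPoly_dvd hy (fun k => ?_) fun k => ?_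
      · obtain ⟨S, hS⟩ := hsplit k
        rw [hS]
        simp only [eval_add, eval_sub, eval_mul, eval_C, eval_X, eval_pow, he]
        have := hQ0 k
        field_simp
        ring
      · obtain ⟨S, hS⟩ := hsplit k
        rw [hS]
        simp only [derivative_add, derivative_sub, derivative_mul, derivative_X_sub_C_sq,
          derivative_C, derivative_X, eval_add, eval_sub, eval_mul, eval_C, eval_X, eval_pow,
          eval_zero, eval_one, he, hd]
        have := hQ0 k
        field_simp
        ring
    have h2 : (P - H).degree < ((2 * m + 1 + 1 : ℕ) : WithBot ℕ) :=
      (degree_sub_le _ _).trans_lt (max_lt hP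
        ((degree_sum_le _ _).trans_lt ((Finset.sup_lt_iff (WithBot.bot_lt_coe _)).2
          fun k _ => hdeg k)))
    have h3 := degree_le_of_dvd hdvd hne
    rw [degree_eq_natDegree (monic_sqPoly y).ne_zero, natDegree_sqPoly] at h3
    exact absurd (h3.trans_lt h2) (by norm_cast; omega)
  calc doubleRes y P = ∑ k, d k := rfl
    _ = H.coeff (2 * m + 1) := by rw [hH, finsetSum_coeff]; simp only [hcoeff]
    _ = P.coeff (2 * m + 1) := by rw [← hPH]

end Interpolation

/-- Complete homogeneous symmetric polynomial of degree two in terms of power sums. -/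
noncomputable def h2p (a b : ℝ) : ℝ := (a ^ 2 + b) / 2

/-- Complete homogeneous symmetric polynomial of degree three in terms of power sums. -/
noncomputable def h3p (a b c : ℝ) : ℝ := (a ^ 3 + 3 * a * b + 2 * c) / 6

/-- The bilinear expression `s_{22}(y) - e_1(x) s_{21}(y) + e_2(x) h_2(y)` in terms of the power
sums `a_i` of `x` and `b_i` of `y`. -/
noncomputable def kpForm (a₁ a₂ b₁ b₂ b₃ : ℝ) : ℝ :=
  (b₁ ^ 4 + 3 * b₂ ^ 2 - 4 * b₁ * b₃) / 12 - a₁ * ((b₁ ^ 3 - b₃) / 3)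
    + (a₁ ^ 2 - a₂) / 2 * h2p b₁ b₂

section Interpolation

open Polynomial

theorem psum_one {n : ℕ} (x : Fin n → ℝ) : psum 1 x = ∑ i, x i := by simp [psum]

theorem psum_two {n : ℕ} (x : Fin n → ℝ) : psum 2 x = ∑ i, x i ^ 2 := rfl

theorem prod_sub_eq_neg_one_pow_mul_eval {n : ℕ} (x : Fin n → ℝ) (t : ℝ) :
    ∏ i, (x i - t) = (-1) ^ n * (∏ i, (X - C (x i))).eval t := by
  rw [eval_prod, ← Fin.prod_const, ← prod_mul_distrib]
  exact prod_congr rfl fun i _ => by simp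

/-- The Lagrange functional with the signs that occur below. -/
theorem sum_eval_mul_prod_div {p m : ℕ} (x : Fin p → ℝ) (y : Fin (m + 1) → ℝ) (F : ℝ[X]) :
    ∑ k, F.eval (y k) * (∏ i, (x i - y k)) / ∏ l, (k.removeNth y l - y k)
      = (-1) ^ (p + m) * simpleRes y (F * ∏ i, (X - C (x i))) := by
  change _ = _ * ∑ k : Fin (m + 1), _
  rw [mul_sum]
  refine sum_congr rfl fun k _ => ?_
  have : ∏ l, (k.removeNth y l - y k) = (-1) ^ m * ∏ l, (y k - k.removeNth y l) := by
    rw [← Fin.prod_const, ← prod_mul_distrib]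
    exact prod_congr rfl fun i _ => by ring
  rw [prod_sub_eq_neg_one_pow_mul_eval, this, eval_mul, pow_add]
  rcases neg_one_pow_eq_or ℝ m with h | h <;> rw [h] <;> simp [div_eq_mul_inv, inv_neg] <;> ring_nf

/-- The cubic polynomial with coefficients given by complete homogeneous polynomials. -/
noncomputable def cubic (a b c : ℝ) : ℝ[X] :=
  X ^ 3 + C a * X ^ 2 + C (h2p a b) * X + C (h3p a b c)

theorem eval_cubic (a b c t : ℝ) :
    (cubic a b c).eval t = h3p (a + t) (b + t ^ 2) (c + t ^ 3) := by
  simp [cubic, h2p, h3p]; ring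

theorem natDegree_cubic (a b c : ℝ) : (cubic a b c).natDegree = 3 := by
  unfold cubic; compute_degree!

theorem monic_cubic (a b c : ℝ) : (cubic a b c).Monic := by
  unfold cubic; monicity!

theorem sum_h3p_mul_prod_div {p : ℕ} (x : Fin p → ℝ) {y : Fin (p + 4) → ℝ}
    (hy : Function.Injective y) :
    ∑ k, h3p (psum 1 x + y k) (psum 2 x + y k ^ 2) (psum 3 x + y k ^ 3) * (∏ i, (x i - y k)) /
      ∏ l, (k.removeNth y l - y k) = -1 := by
  simp only [← eval_cubic]
  have hm : (cubic (psum 1 x) (psum 2 x) (psum 3 x) * ∏ i, (X - C (x i))).Monic :=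
    (monic_cubic _ _ _).mul (monic_prod_of_monic _ _ fun _ _ => monic_X_sub_C _)
  have hd : (cubic (psum 1 x) (psum 2 x) (psum 3 x) * ∏ i, (X - C (x i))).natDegree = p + 3 := by
    rw [(monic_cubic _ _ _).natDegree_mul (monic_prod_of_monic _ _ fun _ _ => monic_X_sub_C _),
      natDegree_cubic, natDegree_prod_of_monic _ _ fun _ _ => monic_X_sub_C _]
    simp [add_comm]
  rw [sum_eval_mul_prod_div (m := p + 3), simpleRes_eq_coeff hy, ← hd, hm.coeff_natDegree]
  · rw [hd, mul_one]
    exact Odd.neg_one_pow ⟨p + 1, by omega⟩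
  · rw [degree_eq_natDegree hm.ne_zero, hd]
    exact_mod_cast Nat.lt_succ_self _

theorem sum_prod_div_eq_zero {m : ℕ} (x : Fin m → ℝ) {y : Fin (m + 2) → ℝ}
    (hy : Function.Injective y) :
    ∑ k, (∏ i, (x i - y k)) / ∏ l, (k.removeNth y l - y k) = 0 := by
  have h := sum_eval_mul_prod_div x y 1
  simp only [eval_one, one_mul] at h
  have hm := monic_prod_of_monic univ (fun i => X - C (x i)) fun _ _ => monic_X_sub_C _
  have hd : (∏ i, (X - C (x i))).natDegree = m := by
    rw [natDegree_prod_of_monic _ _ fun _ _ => monic_X_sub_C _]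
    simp
  rw [h, simpleRes_eq_coeff hy, coeff_eq_zero_of_natDegree_lt (by omega), mul_zero]
  rw [degree_eq_natDegree hm.ne_zero, hd]
  exact_mod_cast Nat.lt_add_of_pos_right two_pos

theorem sum_h3p_removeNth_mul_prod_div {m : ℕ} (x : Fin (m + 1) → ℝ) {y : Fin (m + 1) → ℝ}
    (hy : Function.Injective y) :
    ∑ k, h3p (psum 1 (k.removeNth y)) (psum 2 (k.removeNth y)) (psum 3 (k.removeNth y)) *
      (∏ i, (x i - y k)) / ∏ l, (k.removeNth y l - y k)
      = kpForm (psum 1 x) (psum 2 x) (psum 1 y) (psum 2 y) (psum 3 y) := by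
  have hF : ∀ k, h3p (psum 1 (k.removeNth y)) (psum 2 (k.removeNth y)) (psum 3 (k.removeNth y))
      = (C (h3p (psum 1 y) (psum 2 y) (psum 3 y)) - C (h2p (psum 1 y) (psum 2 y)) * X).eval (y k)
      := fun k => by
    simp only [psum_removeNth, h3p, h2p, eval_sub, eval_mul, eval_C, eval_X]; ring
  simp only [hF]
  have hA := hasTop_prod univ x
  have hB := hasTop_prod univ y
  simp only [card_univ, Fintype.card_fin, ← psum_two] at hA hB
  simp only [← psum_one] at hA hB
  have h0 := simpleRes_mul_eq_zero y 1
  rw [one_mul] at h0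
  obtain ⟨h1, h2⟩ := residue_eval hA hB h0 (simpleRes_mul_eq_zero y X) (simpleRes_eq_coeff hy)
  rw [sum_eval_mul_prod_div, Odd.neg_one_pow ⟨m, by omega⟩, sub_mul, mul_assoc, ← smul_eq_C_mul,
    ← smul_eq_C_mul, map_sub, map_smul, map_smul, h1, h2]
  simp only [kpForm, h2p, h3p, smul_eq_mul]; ring

/-- The Wronskian-type kernel for the quaternionic case. -/
noncomputable def wronK {p q : ℕ} (t : ℝ) (x : Fin p → ℝ) (v : Fin q → ℝ) : ℝ :=
  (derivative (cubic (2 * psum 1 x) (2 * psum 2 x) (2 * psum 3 x) * sqPoly x)).eval t *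
      (sqPoly v).eval t
    - (cubic (2 * psum 1 x) (2 * psum 2 x) (2 * psum 3 x) * sqPoly x).eval t *
      (derivative (sqPoly v)).eval t

theorem sum_wronK_div {p : ℕ} (x : Fin p → ℝ) {y : Fin (p + 2) → ℝ}
    (hy : Function.Injective y) :
    ∑ k, wronK (y k) x (k.removeNth y) / (sqPoly (k.removeNth y)).eval (y k) ^ 2 = 1 := by
  set P := cubic (2 * psum 1 x) (2 * psum 2 x) (2 * psum 3 x) * sqPoly x with hP
  have hm : P.Monic := (monic_cubic _ _ _).mul (monic_sqPoly x)
  have hd : P.natDegree = 2 * (p + 1) + 1 := by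
    rw [(monic_cubic _ _ _).natDegree_mul (monic_sqPoly x), natDegree_cubic, natDegree_sqPoly]
    ring
  calc _ = doubleRes y P := rfl
    _ = 1 := by
      rw [doubleRes_eq_coeff hy, ← hd, hm.coeff_natDegree]
      rw [degree_eq_natDegree hm.ne_zero, hd]
      exact_mod_cast Nat.lt_succ_self _

theorem sum_wronK_removeNth_div {m : ℕ} (v : Fin (m + 1) → ℝ) {y : Fin (m + 1) → ℝ}
    (hy : Function.Injective y) :
    ∑ k, wronK (y k) (k.removeNth y) v / (sqPoly (k.removeNth y)).eval (y k) ^ 2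
      = kpForm (2 * psum 1 v) (2 * psum 2 v) (2 * psum 1 y) (2 * psum 2 y) (2 * psum 3 y) := by
  have hA := hasTop_prod_sq univ v
  have hB := hasTop_prod_sq univ y
  simp only [card_univ, Fintype.card_fin, ← psum_two] at hA hB
  simp only [← psum_one] at hA hB
  have h0 := doubleRes_mul_eq_zero y 1
  rw [one_mul] at h0
  obtain ⟨h1, h2⟩ := residue_eval (D := 2 * m + 1) hA hB h0 (doubleRes_mul_eq_zero y X)
    (doubleRes_eq_coeff hy)
  set H2 := h2p (2 * psum 1 y) (2 * psum 2 y) with hH2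
  set H3 := h3p (2 * psum 1 y) (2 * psum 2 y) (2 * psum 3 y) with hH3
  have key : ∑ k, wronK (y k) (k.removeNth y) v / (sqPoly (k.removeNth y)).eval (y k) ^ 2
      = - doubleRes y ((C H3 - C H2 * X) * sqPoly v) := by
    change _ = -∑ k : Fin (m + 1), _
    rw [← sum_neg_distrib]
    refine sum_congr rfl fun k _ => ?_
    have e1 : (cubic (2 * psum 1 (k.removeNth y)) (2 * psum 2 (k.removeNth y))
        (2 * psum 3 (k.removeNth y))).eval (y k) = H3 - H2 * y k := by
      rw [eval_cubic]
      simp only [psum_removeNth, h3p, h2p, hH2, hH3]; ring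
    have e2 : (derivative (cubic (2 * psum 1 (k.removeNth y)) (2 * psum 2 (k.removeNth y))
        (2 * psum 3 (k.removeNth y)))).eval (y k) = H2 := by
      simp only [cubic, derivative_add, derivative_mul, derivative_X_pow, derivative_C,
        derivative_X, eval_add, eval_mul, eval_C, eval_X, eval_pow, eval_zero, eval_one,
        psum_removeNth, h2p, hH2]
      norm_num
      ring
    simp only [wronK, derivative_mul, derivative_sub, derivative_C, derivative_X, eval_add,
      eval_sub, eval_mul, eval_C, eval_X, eval_zero, eval_one, e1, e2]
    ring
  rw [key, sub_mul, mul_assoc, ← smul_eq_C_mul, ← smul_eq_C_mul, map_sub, map_smul, map_smul]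
  change -(H3 * doubleRes y (∏ i, (X - C (v i)) ^ 2)
    - H2 * doubleRes y (X * ∏ i, (X - C (v i)) ^ 2)) = _
  rw [h1, h2]
  simp only [kpForm, hH2, hH3, h2p, h3p]; ring

end Interpolation

/-- The `n`-fold power of a measure on the line. -/
noncomputable def powM (μ : Measure ℝ) (n : ℕ) : Measure (Fin n → ℝ) := Measure.pi fun _ => μ

instance (μ : Measure ℝ) [IsFiniteMeasure μ] (n : ℕ) : IsFiniteMeasure (powM μ n) := by
  unfold powM; infer_instance

theorem measurePreserving_removeNth (μ : Measure ℝ) [IsFiniteMeasure μ] {n : ℕ} (k : Fin (n + 1)) :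
    MeasurePreserving (fun y : Fin (n + 1) → ℝ => (y k, k.removeNth y)) (powM μ (n + 1))
      (μ.prod (powM μ n)) :=
  measurePreserving_piFinSuccAbove (fun _ => μ) k

theorem measurePreserving_split_snd (μ : Measure ℝ) [IsFiniteMeasure μ] {p q : ℕ}
    (k : Fin (q + 1)) :
    MeasurePreserving
      (fun w : (Fin p → ℝ) × (Fin (q + 1) → ℝ) => (w.2 k, w.1, k.removeNth w.2))
      ((powM μ p).prod (powM μ (q + 1))) (μ.prod ((powM μ p).prod (powM μ q))) := by
  have h1 := (MeasurePreserving.id (powM μ p)).prod (measurePreserving_removeNth μ k)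
  have h2 := (measurePreserving_prodAssoc (powM μ p) μ (powM μ q)).symm
  have h3 := (Measure.measurePreserving_swap (μ := powM μ p) (ν := μ)).prod
    (MeasurePreserving.id (powM μ q))
  have h4 := measurePreserving_prodAssoc μ (powM μ p) (powM μ q)
  exact h4.comp (h3.comp (h2.comp h1))

theorem measurePreserving_split_fst (μ : Measure ℝ) [IsFiniteMeasure μ] {p q : ℕ}
    (k : Fin (p + 1)) :
    MeasurePreserving
      (fun w : (Fin (p + 1) → ℝ) × (Fin q → ℝ) => (w.1 k, k.removeNth w.1, w.2))
      ((powM μ (p + 1)).prod (powM μ q)) (μ.prod ((powM μ p).prod (powM μ q))) :=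
  (measurePreserving_prodAssoc μ (powM μ p) (powM μ q)).comp
    ((measurePreserving_removeNth μ k).prod (MeasurePreserving.id (powM μ q)))

theorem MeasureTheory.MeasurePreserving.integral_comp_of_integrable {X Y : Type*}
    [MeasurableSpace X] [MeasurableSpace Y] {a : Measure X} {b : Measure Y} {f : X → Y}
    (hf : MeasurePreserving f a b) {H : Y → ℝ} (hH : Integrable H b) :
    ∫ x, H (f x) ∂a = ∫ y, H y ∂b := by
  rw [← hf.map_eq, integral_map hf.measurable.aemeasurable]
  rw [hf.map_eq]; exact hH.aestronglyMeasurable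

theorem integral_sum_split_snd (μ : Measure ℝ) [IsFiniteMeasure μ] {p q : ℕ}
    {H : ℝ → (Fin p → ℝ) → (Fin q → ℝ) → ℝ}
    (hH : Integrable (fun w : ℝ × (Fin p → ℝ) × (Fin q → ℝ) => H w.1 w.2.1 w.2.2)
      (μ.prod ((powM μ p).prod (powM μ q)))) :
    ∫ w, ∑ k, H (w.2 k) w.1 (k.removeNth w.2) ∂((powM μ p).prod (powM μ (q + 1)))
      = (q + 1) * ∫ w, H w.1 w.2.1 w.2.2 ∂(μ.prod ((powM μ p).prod (powM μ q))) := by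
  have hi := fun k => (measurePreserving_split_snd μ k).integrable_comp_of_integrable hH
  have hc := fun k => (measurePreserving_split_snd μ k).integral_comp_of_integrable hH
  refine (integral_finsetSum _ fun k _ => hi k).trans ?_
  refine (sum_congr rfl fun k _ => hc k).trans ?_
  simp

theorem integral_sum_split_fst (μ : Measure ℝ) [IsFiniteMeasure μ] {p q : ℕ}
    {H : ℝ → (Fin p → ℝ) → (Fin q → ℝ) → ℝ}
    (hH : Integrable (fun w : ℝ × (Fin p → ℝ) × (Fin q → ℝ) => H w.1 w.2.1 w.2.2)
      (μ.prod ((powM μ p).prod (powM μ q)))) :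
    ∫ w, ∑ k, H (w.1 k) (k.removeNth w.1) w.2 ∂((powM μ (p + 1)).prod (powM μ q))
      = (p + 1) * ∫ w, H w.1 w.2.1 w.2.2 ∂(μ.prod ((powM μ p).prod (powM μ q))) := by
  have hi := fun k => (measurePreserving_split_fst μ k).integrable_comp_of_integrable hH
  have hc := fun k => (measurePreserving_split_fst μ k).integral_comp_of_integrable hH
  refine (integral_finsetSum _ fun k _ => hi k).trans ?_
  refine (sum_congr rfl fun k _ => hc k).trans ?_
  simp

theorem integrable_of_abs_le_continuous {X : Type*} [TopologicalSpace X] [MeasurableSpace X]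
    [OpensMeasurableSpace X] {ν : Measure X} [IsFiniteMeasure ν] {K : Set X} (hK : IsCompact K)
    (hν : ∀ᵐ x ∂ν, x ∈ K) {f g : X → ℝ} (hf : Measurable f) (hg : Continuous g)
    (hfg : ∀ x, |f x| ≤ |g x|) : Integrable f ν := by
  obtain ⟨C, hC⟩ := hK.exists_bound_of_continuousOn hg.continuousOn
  refine Integrable.of_bound hf.aestronglyMeasurable C ?_
  filter_upwards [hν] with x hx
  exact (hfg x).trans (hC x hx)

theorem ae_powM_mem_Icc {μ : Measure ℝ} [IsFiniteMeasure μ] (hμ : ∀ᵐ t ∂μ, t ∈ Set.Icc (0 : ℝ) 1)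
    (n : ℕ) : ∀ᵐ x ∂(powM μ n), x ∈ Set.Icc (0 : Fin n → ℝ) 1 := by
  have : ∀ i : Fin n, ∀ᵐ x ∂(powM μ n), x i ∈ Set.Icc (0 : ℝ) 1 := fun i =>
    (Measure.tendsto_eval_ae_ae (μ := fun _ : Fin n => μ) (i := i)) hμ
  filter_upwards [ae_all_iff.2 this] with x hx
  exact ⟨fun i => (hx i).1, fun i => (hx i).2⟩

theorem ae_prod_mem {X Y : Type*} [MeasurableSpace X] [MeasurableSpace Y] {a : Measure X}
    {b : Measure Y} [SFinite a] [SFinite b] {s : Set X} {t : Set Y} (hs : ∀ᵐ x ∂a, x ∈ s)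
    (ht : ∀ᵐ y ∂b, y ∈ t) : ∀ᵐ w ∂(a.prod b), w ∈ s ×ˢ t := by
  filter_upwards [Measure.quasiMeasurePreserving_fst.ae hs,
    Measure.quasiMeasurePreserving_snd.ae ht] with w h1 h2
  exact ⟨h1, h2⟩

theorem ae_powM_apply_ne (μ : Measure ℝ) [IsFiniteMeasure μ] [NullSingletonClass μ] {n : ℕ}
    (i : Fin n) (t : ℝ) : ∀ᵐ x ∂(powM μ n), x i ≠ t :=
  Measure.ae_eval_ne (μ := fun _ : Fin n => μ) i t

theorem ae_powM_prod_ne (μ : Measure ℝ) [IsFiniteMeasure μ] [NullSingletonClass μ] {p q : ℕ}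
    (i : Fin p) (j : Fin q) : ∀ᵐ w ∂((powM μ p).prod (powM μ q)), w.1 i ≠ w.2 j := by
  rw [Measure.ae_prod_iff_ae_ae]
  · filter_upwards with x
    filter_upwards [ae_powM_apply_ne μ j (x i)] with y hy using hy.symm
  · exact (measurableSet_eq_fun (by fun_prop) (by fun_prop)).compl

theorem ae_powM_injective (μ : Measure ℝ) [IsFiniteMeasure μ] [NullSingletonClass μ] (n : ℕ) :
    ∀ᵐ x ∂(powM μ n), Function.Injective x := by
  rcases n with _ | n
  · filter_upwards with x using Function.injective_of_subsingleton x
  have : ∀ (i : Fin (n + 1)) (j : Fin n), ∀ᵐ x ∂(powM μ (n + 1)), x i ≠ x (i.succAbove j) := by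
    intro i j
    have h : ∀ᵐ w ∂(μ.prod (powM μ n)), w.1 ≠ w.2 j := by
      rw [Measure.ae_prod_iff_ae_ae]
      · filter_upwards with t
        filter_upwards [ae_powM_apply_ne μ j t] with y hy using hy.symm
      · exact (measurableSet_eq_fun (by fun_prop) (by fun_prop)).compl
    exact (measurePreserving_removeNth μ i).quasiMeasurePreserving.ae h
  filter_upwards [ae_all_iff.2 fun i => ae_all_iff.2 (this i)] with x hx i j hij
  by_contra hne
  obtain ⟨l, rfl⟩ := Fin.exists_succAbove_eq (Ne.symm hne)
  exact hx i l hij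

theorem ae_powM_sumElim_injective (μ : Measure ℝ) [IsFiniteMeasure μ] [NullSingletonClass μ]
    (p q : ℕ) :
    ∀ᵐ w ∂((powM μ p).prod (powM μ q)), Function.Injective (Sum.elim w.1 w.2) := by
  filter_upwards [Measure.quasiMeasurePreserving_fst.ae (ae_powM_injective μ p),
    Measure.quasiMeasurePreserving_snd.ae (ae_powM_injective μ q),
    ae_all_iff.2 fun i => ae_all_iff.2 (ae_powM_prod_ne μ (p := p) (q := q) i)] with w h1 h2 h3
  exact h1.sumElim h2 h3

theorem ae_powM_snd_injective (μ : Measure ℝ) [IsFiniteMeasure μ] [NullSingletonClass μ]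
    (p q : ℕ) : ∀ᵐ w ∂((powM μ p).prod (powM μ q)), Function.Injective w.2 :=
  Measure.quasiMeasurePreserving_snd.ae (ae_powM_injective μ q)

theorem ae_powM_fst_injective (μ : Measure ℝ) [IsFiniteMeasure μ] [NullSingletonClass μ]
    (p q : ℕ) : ∀ᵐ w ∂((powM μ p).prod (powM μ q)), Function.Injective w.1 :=
  Measure.quasiMeasurePreserving_fst.ae (ae_powM_injective μ p)

theorem continuous_vand {β : ℝ} (hβ : 0 ≤ β) (n : ℕ) : Continuous (vand β (n := n)) := by
  unfold vand
  refine continuous_finsetProd _ fun j _ => continuous_finsetProd _ fun k _ => ?_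
  exact Continuous.rpow_const (by fun_prop) fun _ => Or.inr hβ

/-- The bilinear form obtained by integrating `kpForm`, with power sums scaled by `c`. -/
noncomputable def kpInt (μ : Measure ℝ) (β c : ℝ) (n : ℕ) : ℝ :=
  ∫ w, vand β w.1 * vand β w.2 *
    kpForm (c * psum 1 w.1) (c * psum 2 w.1) (c * psum 1 w.2) (c * psum 2 w.2) (c * psum 3 w.2)
    ∂((powM μ n).prod (powM μ n))

@[fun_prop]
theorem continuous_psum (r n : ℕ) : Continuous (psum r (n := n)) := by
  unfold psum; fun_prop

theorem sg_eq_abs_div_self {x : ℝ} : sg x = |x| / x := by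
  rcases eq_or_ne x 0 with rfl | h
  · simp [sg]
  · have := abs_pos.2 h
    rw [sg, div_eq_div_iff this.ne' h, ← sq, ← sq, sq_abs]

theorem prod_sg_mul_vand {m : ℕ} (y : Fin (m + 1) → ℝ) (k : Fin (m + 1)) :
    (∏ l, sg (k.removeNth y l - y k)) * vand 1 (k.removeNth y)
      = vand 1 y / ∏ l, (k.removeNth y l - y k) := by
  rw [vand_eq_removeNth 1 y k]
  simp only [sg_eq_abs_div_self, Real.rpow_one, prod_div_distrib]
  ring

theorem prod_sub_mul_vand {m : ℕ} (y : Fin (m + 1) → ℝ) (k : Fin (m + 1)) :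
    (∏ l, (k.removeNth y l - y k)) * vand 1 (k.removeNth y)
      = vand 1 y * ∏ l, sg (k.removeNth y l - y k) := by
  rw [vand_eq_removeNth 1 y k, mul_assoc, ← prod_mul_distrib]
  simp only [Real.rpow_one, abs_mul_sg]
  ring

theorem prod_sub_mul_vand_two {m : ℕ} {y : Fin (m + 1) → ℝ} (hy : Function.Injective y)
    (k : Fin (m + 1)) :
    (∏ l, (k.removeNth y l - y k)) * vand 2 (k.removeNth y)
      = vand 2 y / ∏ l, (k.removeNth y l - y k) := by
  have h : ∏ l, (k.removeNth y l - y k) ≠ 0 := prod_ne_zero_iff.2 fun l _ =>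
    sub_ne_zero.2 fun e => Fin.succAbove_ne k l (hy e)
  rw [eq_div_iff h, vand_eq_removeNth 2 y k]
  simp only [show (2 : ℝ) = ((2 : ℕ) : ℝ) by norm_num, Real.rpow_natCast, sq_abs, prod_pow]
  ring

theorem vand_four_eq {m : ℕ} {y : Fin (m + 1) → ℝ} (hy : Function.Injective y)
    (k : Fin (m + 1)) :
    vand 4 (k.removeNth y) = vand 4 y / (sqPoly (k.removeNth y)).eval (y k) ^ 2 := by
  have h := eval_sqPoly_removeNth_ne_zero hy k
  rw [eq_div_iff (pow_ne_zero 2 h), vand_eq_removeNth 4 y k, eval_sqPoly, ← prod_pow]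
  congr 1
  refine prod_congr rfl fun l _ => ?_
  rw [show (4 : ℝ) = ((4 : ℕ) : ℝ) by norm_num, Real.rpow_natCast, ← pow_mul,
    show (2 * 2 : ℕ) = 4 by norm_num, ← abs_pow]
  exact (abs_of_nonneg (by positivity)).symm

instance (μ : Measure ℝ) [IsFiniteMeasure μ] (n : ℕ) : SFinite (powM μ n) :=
  inferInstance

section Bilinear

variable {μ : Measure ℝ} [IsFiniteMeasure μ]

theorem integrable_split {p q : ℕ} (hμ : ∀ᵐ t ∂μ, t ∈ Set.Icc (0 : ℝ) 1)
    {f g : ℝ × (Fin p → ℝ) × (Fin q → ℝ) → ℝ} (hf : Measurable f) (hg : Continuous g)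
    (hfg : ∀ x, |f x| ≤ |g x|) : Integrable f (μ.prod ((powM μ p).prod (powM μ q))) :=
  integrable_of_abs_le_continuous
    (isCompact_Icc.prod (isCompact_Icc.prod isCompact_Icc))
    (ae_prod_mem hμ (ae_prod_mem (ae_powM_mem_Icc hμ p) (ae_powM_mem_Icc hμ q))) hf hg hfg

theorem abs_prod_sg_le_one {n : ℕ} (x : Fin n → ℝ) : |∏ i, sg (x i)| ≤ 1 := by
  rw [abs_prod]
  exact prod_le_one (fun _ _ => abs_nonneg _) fun _ _ => abs_sg_le_one _

theorem kpInt_one (hμ : ∀ᵐ t ∂μ, t ∈ Set.Icc (0 : ℝ) 1) [NullSingletonClass μ] (m : ℕ) :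
    ((m : ℝ) + 3) * (m + 4) * kpInt μ 1 1 (m + 2) = (m + 1) * (m + 2) *
      ((∫ x, vand 1 x ∂(powM μ m)) * ∫ x, vand 1 x ∂(powM μ (m + 4))) := by
  let H1 : ℝ → (Fin m → ℝ) → (Fin (m + 3) → ℝ) → ℝ := fun t x v =>
    (∏ l, sg (v l - t)) *
      (h3p (psum 1 x + t) (psum 2 x + t ^ 2) (psum 3 x + t ^ 3) * (∏ i, (x i - t)) *
        vand 1 x * vand 1 v)
  let H2 : ℝ → (Fin (m + 2) → ℝ) → (Fin (m + 1) → ℝ) → ℝ := fun t x u =>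
    (∏ l, sg (u l - t)) *
      (h3p (psum 1 u) (psum 2 u) (psum 3 u) * (∏ i, (x i - t)) * vand 1 x * vand 1 u)
  have cv : ∀ n, Continuous (vand 1 (n := n)) := fun n => continuous_vand zero_le_one n
  have i1 : Integrable (fun w : ℝ × (Fin m → ℝ) × (Fin (m + 3) → ℝ) => H1 w.1 w.2.1 w.2.2)
      (μ.prod ((powM μ m).prod (powM μ (m + 3)))) := by
    have c : Continuous fun w : ℝ × (Fin m → ℝ) × (Fin (m + 3) → ℝ) =>
      h3p (psum 1 w.2.1 + w.1) (psum 2 w.2.1 + w.1 ^ 2) (psum 3 w.2.1 + w.1 ^ 3) *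
        (∏ i, (w.2.1 i - w.1)) * vand 1 w.2.1 * vand 1 w.2.2 := by
      unfold h3p; fun_prop
    refine integrable_split hμ (Measurable.mul ?_ c.measurable) c fun w => ?_
    · exact Finset.measurable_prod _ fun l _ => measurable_sg.comp (by fun_prop)
    · rw [abs_mul]
      exact mul_le_of_le_one_left (abs_nonneg _) (abs_prod_sg_le_one fun l => w.2.2 l - w.1)
  have i2 : Integrable (fun w : ℝ × (Fin (m + 2) → ℝ) × (Fin (m + 1) → ℝ) => H2 w.1 w.2.1 w.2.2)
      (μ.prod ((powM μ (m + 2)).prod (powM μ (m + 1)))) := by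
    have c : Continuous fun w : ℝ × (Fin (m + 2) → ℝ) × (Fin (m + 1) → ℝ) =>
      h3p (psum 1 w.2.2) (psum 2 w.2.2) (psum 3 w.2.2) *
        (∏ i, (w.2.1 i - w.1)) * vand 1 w.2.1 * vand 1 w.2.2 := by
      unfold h3p; fun_prop
    refine integrable_split hμ (Measurable.mul ?_ c.measurable) c fun w => ?_
    · exact Finset.measurable_prod _ fun l _ => measurable_sg.comp (by fun_prop)
    · rw [abs_mul]
      exact mul_le_of_le_one_left (abs_nonneg _) (abs_prod_sg_le_one fun l => w.2.2 l - w.1)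
  have a1 := integral_sum_split_snd μ i1
  have a2 := integral_sum_split_fst μ i1
  have b1 := integral_sum_split_snd μ i2
  have b2 := integral_sum_split_fst μ i2
  have a1' : ∫ w, ∑ k, H1 (w.2 k) w.1 (k.removeNth w.2) ∂((powM μ m).prod (powM μ (m + 3 + 1)))
      = -((∫ x, vand 1 x ∂(powM μ m)) * ∫ x, vand 1 x ∂(powM μ (m + 4))) := by
    rw [← integral_prod_mul, ← integral_neg]
    refine integral_congr_ae ?_
    filter_upwards [ae_powM_snd_injective μ m (m + 4)] with w hw
    trans vand 1 w.1 * vand 1 w.2 * ∑ k, h3p (psum 1 w.1 + w.2 k) (psum 2 w.1 + w.2 k ^ 2)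
      (psum 3 w.1 + w.2 k ^ 3) * (∏ i, (w.1 i - w.2 k)) / ∏ l, (k.removeNth w.2 l - w.2 k)
    · rw [mul_sum]
      refine sum_congr rfl fun k _ => ?_
      have := prod_sg_mul_vand w.2 k
      simp only [H1]
      linear_combination (h3p (psum 1 w.1 + w.2 k) (psum 2 w.1 + w.2 k ^ 2)
        (psum 3 w.1 + w.2 k ^ 3) * (∏ i, (w.1 i - w.2 k)) * vand 1 w.1) * this
    · rw [sum_h3p_mul_prod_div w.1 hw]; ring
  have b1' : ∫ w, ∑ k, H2 (w.2 k) w.1 (k.removeNth w.2)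
      ∂((powM μ (m + 2)).prod (powM μ (m + 1 + 1))) = kpInt μ 1 1 (m + 2) := by
    refine integral_congr_ae ?_
    filter_upwards [ae_powM_snd_injective μ (m + 2) (m + 2)] with w hw
    simp only [one_mul]
    rw [← sum_h3p_removeNth_mul_prod_div w.1 hw, mul_sum]
    refine sum_congr rfl fun k _ => ?_
    have := prod_sg_mul_vand w.2 k
    simp only [H2]
    linear_combination (h3p (psum 1 (k.removeNth w.2)) (psum 2 (k.removeNth w.2))
        (psum 3 (k.removeNth w.2)) * (∏ i, (w.1 i - w.2 k)) * vand 1 w.1) * this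
  have ab : (∫ w, ∑ k, H1 (w.1 k) (k.removeNth w.1) w.2
        ∂((powM μ (m + 1)).prod (powM μ (m + 3))))
      + ∫ w, ∑ k, H2 (w.1 k) (k.removeNth w.1) w.2
        ∂((powM μ (m + 2 + 1)).prod (powM μ (m + 1))) = 0 := by
    have sw : ∫ w, ∑ k, H2 (w.1 k) (k.removeNth w.1) w.2
          ∂((powM μ (m + 2 + 1)).prod (powM μ (m + 1)))
        = ∫ w, ∑ k, H2 (w.2 k) (k.removeNth w.2) w.1
          ∂((powM μ (m + 1)).prod (powM μ (m + 2 + 1))) :=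
      (integral_prod_swap fun w : (Fin (m + 2 + 1) → ℝ) × (Fin (m + 1) → ℝ) =>
        ∑ k, H2 (w.1 k) (k.removeNth w.1) w.2).symm
    rw [sw, ← integral_add]
    · refine integral_eq_zero_of_ae ?_
      filter_upwards [ae_powM_sumElim_injective μ (m + 1) (m + 3)] with w hw
      have := sum_removeNth_sg_add (p := m) (q := m + 2) ⟨m + 1, by ring⟩ w.1 w.2 hw
      have e1 : ∑ k, H1 (w.1 k) (k.removeNth w.1) w.2 =
          h3p (psum 1 w.1) (psum 2 w.1) (psum 3 w.1) * vand 1 w.1 * vand 1 w.2 *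
          ∑ k, (∏ i, sg (k.removeNth w.1 i - w.1 k)) * ∏ l, sg (w.2 l - w.1 k) := by
        rw [mul_sum]
        refine sum_congr rfl fun k _ => ?_
        have := prod_sub_mul_vand w.1 k
        simp only [H1, psum_removeNth, pow_one, sub_add_cancel]
        linear_combination ((∏ l, sg (w.2 l - w.1 k)) *
          h3p (psum 1 w.1) (psum 2 w.1) (psum 3 w.1) * vand 1 w.2) * this
      have e2 : ∑ k, H2 (w.2 k) (k.removeNth w.2) w.1 =
          h3p (psum 1 w.1) (psum 2 w.1) (psum 3 w.1) * vand 1 w.1 * vand 1 w.2 *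
          ∑ k, (∏ i, sg (k.removeNth w.2 i - w.2 k)) * ∏ l, sg (w.1 l - w.2 k) := by
        rw [mul_sum]
        refine sum_congr rfl fun k _ => ?_
        have := prod_sub_mul_vand w.2 k
        simp only [H2]
        linear_combination ((∏ l, sg (w.1 l - w.2 k)) *
          h3p (psum 1 w.1) (psum 2 w.1) (psum 3 w.1) * vand 1 w.1) * this
      simp only [Pi.zero_apply]
      rw [e1, e2, ← mul_add, this, mul_zero]
    · exact integrable_finsetSum _ fun k _ =>
        (measurePreserving_split_fst μ k).integrable_comp_of_integrable i1
    · exact integrable_finsetSum _ fun k _ =>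
        ((measurePreserving_split_fst μ k).comp
          Measure.measurePreserving_swap).integrable_comp_of_integrable i2
  rw [a1'] at a1
  rw [b1'] at b1
  rw [a2, b2] at ab
  push_cast at a1 b1 ab
  set I1 := ∫ w : ℝ × (Fin m → ℝ) × (Fin (m + 3) → ℝ), H1 w.1 w.2.1 w.2.2
    ∂(μ.prod ((powM μ m).prod (powM μ (m + 3))))
  set I2 := ∫ w : ℝ × (Fin (m + 2) → ℝ) × (Fin (m + 1) → ℝ), H2 w.1 w.2.1 w.2.2
    ∂(μ.prod ((powM μ (m + 2)).prod (powM μ (m + 1))))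
  linear_combination ((m : ℝ) + 3) * (m + 4) * b1 + (m + 1) * (m + 2) * a1
    + (m + 2) * (m + 4) * ab

theorem kpInt_two (hμ : ∀ᵐ t ∂μ, t ∈ Set.Icc (0 : ℝ) 1) [NullSingletonClass μ] (m : ℕ) :
    kpInt μ 2 1 (m + 1) = 0 := by
  let H : ℝ → (Fin (m + 1) → ℝ) → (Fin m → ℝ) → ℝ := fun t x u =>
    h3p (psum 1 u) (psum 2 u) (psum 3 u) * (∏ i, (x i - t)) * vand 2 x *
      (∏ l, (u l - t)) * vand 2 u
  have cv : ∀ n, Continuous (vand 2 (n := n)) := fun n => continuous_vand zero_le_two n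
  have i1 : Integrable (fun w : ℝ × (Fin (m + 1) → ℝ) × (Fin m → ℝ) => H w.1 w.2.1 w.2.2)
      (μ.prod ((powM μ (m + 1)).prod (powM μ m))) := by
    have c : Continuous fun w : ℝ × (Fin (m + 1) → ℝ) × (Fin m → ℝ) => H w.1 w.2.1 w.2.2 := by
      unfold H h3p; fun_prop
    exact integrable_split hμ c.measurable c fun w => le_rfl
  have a1 := integral_sum_split_snd μ i1
  have a2 := integral_sum_split_fst μ i1
  have a1' : ∫ w, ∑ k, H (w.2 k) w.1 (k.removeNth w.2)
      ∂((powM μ (m + 1)).prod (powM μ (m + 1))) = kpInt μ 2 1 (m + 1) := by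
    refine integral_congr_ae ?_
    filter_upwards [ae_powM_snd_injective μ (m + 1) (m + 1)] with w hw
    simp only [one_mul]
    rw [← sum_h3p_removeNth_mul_prod_div w.1 hw, mul_sum]
    refine sum_congr rfl fun k _ => ?_
    have := prod_sub_mul_vand_two hw k
    simp only [H]
    linear_combination (h3p (psum 1 (k.removeNth w.2)) (psum 2 (k.removeNth w.2))
        (psum 3 (k.removeNth w.2)) * (∏ i, (w.1 i - w.2 k)) * vand 2 w.1) * this
  have a2' : ∫ w, ∑ k, H (w.1 k) (k.removeNth w.1) w.2
      ∂((powM μ (m + 1 + 1)).prod (powM μ m)) = 0 := by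
    refine integral_eq_zero_of_ae ?_
    filter_upwards [ae_powM_fst_injective μ (m + 2) m] with w hw
    trans h3p (psum 1 w.2) (psum 2 w.2) (psum 3 w.2) * vand 2 w.1 * vand 2 w.2 *
      ∑ k, (∏ i, (w.2 i - w.1 k)) / ∏ l, (k.removeNth w.1 l - w.1 k)
    · rw [mul_sum]
      refine sum_congr rfl fun k _ => ?_
      have := prod_sub_mul_vand_two hw k
      simp only [H]
      linear_combination (h3p (psum 1 w.2) (psum 2 w.2) (psum 3 w.2) *
        (∏ i, (w.2 i - w.1 k)) * vand 2 w.2) * this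
    · rw [sum_prod_div_eq_zero w.2 hw, mul_zero]; rfl
  rw [a1'] at a1
  rw [a2'] at a2
  have : ((m + 1 : ℕ) : ℝ) + 1 ≠ 0 := by positivity
  rw [a1, (mul_eq_zero.1 a2.symm).resolve_left this, mul_zero]

theorem continuous_wronK (p q : ℕ) :
    Continuous fun w : ℝ × (Fin p → ℝ) × (Fin q → ℝ) => wronK w.1 w.2.1 w.2.2 := by
  have e1 : ∀ n, Continuous fun w : ℝ × (Fin n → ℝ) => (sqPoly w.2).eval w.1 := fun n => by
    simp only [eval_sqPoly]; fun_prop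
  have e2 : ∀ n, Continuous fun w : ℝ × (Fin n → ℝ) =>
      (Polynomial.derivative (sqPoly w.2)).eval w.1 := fun n => by
    simp only [sqPoly, Polynomial.derivative_prod_finset, Polynomial.eval_finsetSum,
      Polynomial.eval_mul, Polynomial.eval_prod, Polynomial.derivative_X_sub_C_pow,
      Polynomial.eval_pow, Polynomial.eval_sub, Polynomial.eval_X, Polynomial.eval_C]
    fun_prop
  have f1 := (e1 p).comp (g := fun w : ℝ × (Fin p → ℝ) => (sqPoly w.2).eval w.1)
    (f := fun w : ℝ × (Fin p → ℝ) × (Fin q → ℝ) => (w.1, w.2.1)) (by fun_prop)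
  have f2 := (e2 p).comp
    (f := fun w : ℝ × (Fin p → ℝ) × (Fin q → ℝ) => (w.1, w.2.1)) (by fun_prop)
  have g1 := (e1 q).comp
    (f := fun w : ℝ × (Fin p → ℝ) × (Fin q → ℝ) => (w.1, w.2.2)) (by fun_prop)
  have g2 := (e2 q).comp
    (f := fun w : ℝ × (Fin p → ℝ) × (Fin q → ℝ) => (w.1, w.2.2)) (by fun_prop)
  simp only [Function.comp_def] at f1 f2 g1 g2
  simp only [wronK, cubic, Polynomial.derivative_mul, Polynomial.eval_mul, Polynomial.eval_add,
    Polynomial.derivative_add, Polynomial.derivative_X_pow, Polynomial.derivative_C,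
    Polynomial.derivative_X, Polynomial.eval_C, Polynomial.eval_X, Polynomial.eval_pow, h2p, h3p,
    Polynomial.eval_zero, Polynomial.eval_one]
  fun_prop

theorem kpInt_four (hμ : ∀ᵐ t ∂μ, t ∈ Set.Icc (0 : ℝ) 1) [NullSingletonClass μ] (m : ℕ) :
    ((m : ℝ) + 2) * kpInt μ 4 2 (m + 1) = (m + 1) *
      ((∫ x, vand 4 x ∂(powM μ m)) * ∫ x, vand 4 x ∂(powM μ (m + 2))) := by
  let H : ℝ → (Fin m → ℝ) → (Fin (m + 1) → ℝ) → ℝ := fun t x v =>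
    wronK t x v * vand 4 x * vand 4 v
  have cv : ∀ n, Continuous (vand 4 (n := n)) := fun n => continuous_vand zero_le_four n
  have i1 : Integrable (fun w : ℝ × (Fin m → ℝ) × (Fin (m + 1) → ℝ) => H w.1 w.2.1 w.2.2)
      (μ.prod ((powM μ m).prod (powM μ (m + 1)))) := by
    have cw := continuous_wronK m (m + 1)
    have c : Continuous fun w : ℝ × (Fin m → ℝ) × (Fin (m + 1) → ℝ) => H w.1 w.2.1 w.2.2 := by
      unfold H; fun_prop
    exact integrable_split hμ c.measurable c fun w => le_rfl
  have a1 := integral_sum_split_snd μ i1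
  have a2 := integral_sum_split_fst μ i1
  have a1' : ∫ w, ∑ k, H (w.2 k) w.1 (k.removeNth w.2) ∂((powM μ m).prod (powM μ (m + 1 + 1)))
      = (∫ x, vand 4 x ∂(powM μ m)) * ∫ x, vand 4 x ∂(powM μ (m + 2)) := by
    rw [← integral_prod_mul]
    refine integral_congr_ae ?_
    filter_upwards [ae_powM_snd_injective μ m (m + 2)] with w hw
    rw [← mul_one (vand 4 w.1 * vand 4 w.2), ← sum_wronK_div w.1 hw, mul_sum]
    refine sum_congr rfl fun k _ => ?_
    simp only [H]
    rw [vand_four_eq hw k]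
    ring
  have a2' : ∫ w, ∑ k, H (w.1 k) (k.removeNth w.1) w.2
      ∂((powM μ (m + 1)).prod (powM μ (m + 1))) = kpInt μ 4 2 (m + 1) := by
    rw [← integral_prod_swap]
    refine integral_congr_ae ?_
    filter_upwards [ae_powM_snd_injective μ (m + 1) (m + 1)] with w hw
    rw [← sum_wronK_removeNth_div w.1 hw, mul_sum]
    refine sum_congr rfl fun k _ => ?_
    simp only [H, Prod.fst_swap, Prod.snd_swap]
    rw [vand_four_eq hw k]
    ring
  rw [a1'] at a1
  rw [a2'] at a2
  push_cast at a1
  linear_combination ((m : ℝ) + 2) * a2 - (m + 1) * a1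

theorem integrable_mul_vand (hμ : ∀ᵐ t ∂μ, t ∈ Set.Icc (0 : ℝ) 1) {β : ℝ} (hβ : 0 ≤ β) {n : ℕ}
    {f : (Fin n → ℝ) → ℝ} (hf : Continuous f) :
    Integrable (fun x => f x * vand β x) (powM μ n) := by
  have c : Continuous fun x => f x * vand β x := hf.mul (continuous_vand hβ n)
  exact integrable_of_abs_le_continuous isCompact_Icc (ae_powM_mem_Icc hμ n) c.measurable c
    fun _ => le_rfl

/-- `kpInt` as a combination of products of moments. -/
theorem twelve_mul_kpInt (hμ : ∀ᵐ t ∂μ, t ∈ Set.Icc (0 : ℝ) 1) {β : ℝ} (hβ : 0 ≤ β) (c : ℝ)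
    (n : ℕ) {m : ℕ → ℝ} {P2 P3 P22 P13 : ℝ}
    (hm : ∀ k, m k = ∫ x, psum 1 x ^ k * vand β x ∂(powM μ n))
    (hP2 : P2 = ∫ x, psum 2 x * vand β x ∂(powM μ n))
    (hP3 : P3 = ∫ x, psum 3 x * vand β x ∂(powM μ n))
    (hP22 : P22 = ∫ x, psum 2 x ^ 2 * vand β x ∂(powM μ n))
    (hP13 : P13 = ∫ x, psum 1 x * psum 3 x * vand β x ∂(powM μ n)) :
    12 * kpInt μ β c n = c ^ 4 * (m 0 * m 4 - 4 * (m 1 * m 3) + 3 * m 2 ^ 2)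
      + c ^ 2 * (3 * (m 0 * P22 - P2 ^ 2) - 4 * (m 0 * P13 - m 1 * P3)) := by
  have hi : ∀ {f : (Fin n → ℝ) → ℝ}, Continuous f →
      Integrable (fun x => f x * vand β x) (powM μ n) := integrable_mul_vand hμ hβ
  have hp : ∀ f g : (Fin n → ℝ) → ℝ,
      ∫ w, (f w.1 * vand β w.1) * (g w.2 * vand β w.2) ∂((powM μ n).prod (powM μ n))
        = (∫ x, f x * vand β x ∂(powM μ n)) * ∫ x, g x * vand β x ∂(powM μ n) := fun f g =>
    integral_prod_mul (fun x => f x * vand β x) fun x => g x * vand β x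
  have hpi : ∀ {f g : (Fin n → ℝ) → ℝ}, Continuous f → Continuous g →
      Integrable (fun w : (Fin n → ℝ) × (Fin n → ℝ) =>
        (f w.1 * vand β w.1) * (g w.2 * vand β w.2)) ((powM μ n).prod (powM μ n)) :=
    fun hf hg => (hi hf).mul_prod (hi hg)
  have lin : ∀ (a b : ℝ) {f g : (Fin n → ℝ) → ℝ}, Continuous f → Continuous g →
      ∫ x, (a * f x + b * g x) * vand β x ∂(powM μ n)
        = a * (∫ x, f x * vand β x ∂(powM μ n)) + b * ∫ x, g x * vand β x ∂(powM μ n) := by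
    intro a b f g hf hg
    rw [← integral_const_mul, ← integral_const_mul, ← integral_add]
    · exact integral_congr_ae (ae_of_all _ fun w => by ring)
    · exact (hi hf).const_mul a
    · exact (hi hg).const_mul b
  have s : kpInt μ β c n = ∫ w, ((psum 1 w.1 ^ 0 * vand β w.1) *
        ((c ^ 4 / 12 * psum 1 w.2 ^ 4 + 1 * (c ^ 2 / 4 * psum 2 w.2 ^ 2
          + (-(c ^ 2 / 3)) * (psum 1 w.2 * psum 3 w.2))) * vand β w.2)
      + ((psum 1 w.1 ^ 1 * vand β w.1) *
        ((c ^ 2 / 3 * psum 3 w.2 + (-(c ^ 4 / 3)) * psum 1 w.2 ^ 3) * vand β w.2)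
      + ((c ^ 2 / 2) * psum 1 w.1 ^ 2 + (-(c / 2)) * psum 2 w.1) * vand β w.1 *
        (((c ^ 2 / 2) * psum 1 w.2 ^ 2 + (c / 2) * psum 2 w.2) * vand β w.2)))
      ∂((powM μ n).prod (powM μ n)) := by
    refine integral_congr_ae (ae_of_all _ fun w => ?_)
    simp only [kpForm, h2p]; ring
  have add3 : ∀ {F G K : (Fin n → ℝ) × (Fin n → ℝ) → ℝ},
      Integrable F ((powM μ n).prod (powM μ n)) → Integrable G ((powM μ n).prod (powM μ n)) →
      Integrable K ((powM μ n).prod (powM μ n)) →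
      ∫ w, (F w + (G w + K w)) ∂((powM μ n).prod (powM μ n))
        = (∫ w, F w ∂((powM μ n).prod (powM μ n))) + ((∫ w, G w ∂((powM μ n).prod (powM μ n)))
          + ∫ w, K w ∂((powM μ n).prod (powM μ n))) := fun hF hG hK => by
    rw [← integral_add hG hK]; exact integral_add hF (hG.add hK)
  rw [s, add3 (hpi (f := fun x => psum 1 x ^ 0)
      (g := fun x => c ^ 4 / 12 * psum 1 x ^ 4 + 1 * (c ^ 2 / 4 * psum 2 x ^ 2
          + (-(c ^ 2 / 3)) * (psum 1 x * psum 3 x))) (by fun_prop) (by fun_prop))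
    (hpi (f := fun x => psum 1 x ^ 1)
      (g := fun x => c ^ 2 / 3 * psum 3 x + (-(c ^ 4 / 3)) * psum 1 x ^ 3)
      (by fun_prop) (by fun_prop))
    (hpi (f := fun x => (c ^ 2 / 2) * psum 1 x ^ 2 + (-(c / 2)) * psum 2 x)
        (g := fun x => (c ^ 2 / 2) * psum 1 x ^ 2 + (c / 2) * psum 2 x)
        (by fun_prop) (by fun_prop)),
    hp (fun x => psum 1 x ^ 0) (fun x => c ^ 4 / 12 * psum 1 x ^ 4 + 1 * (c ^ 2 / 4 * psum 2 x ^ 2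
          + (-(c ^ 2 / 3)) * (psum 1 x * psum 3 x))),
    hp (fun x => psum 1 x ^ 1) (fun x => c ^ 2 / 3 * psum 3 x + (-(c ^ 4 / 3)) * psum 1 x ^ 3),
    hp (fun x => (c ^ 2 / 2) * psum 1 x ^ 2 + (-(c / 2)) * psum 2 x)
      (fun x => (c ^ 2 / 2) * psum 1 x ^ 2 + (c / 2) * psum 2 x),
    lin _ _ (by fun_prop) (by fun_prop), lin _ _ (by fun_prop) (by fun_prop),
    lin _ _ (by fun_prop) (by fun_prop), lin _ _ (by fun_prop) (by fun_prop),
    lin _ _ (by fun_prop) (by fun_prop)]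
  simp only [hm, hP2, hP3, hP22, hP13]
  ring

end Bilinear

theorem lintegral_prod_powM (μ : Measure ℝ) [IsFiniteMeasure μ] :
    ∀ (n : ℕ) (f : Fin n → ℝ → ENNReal), (∀ i, Measurable (f i)) →
      ∫⁻ x, ∏ i, f i (x i) ∂(powM μ n) = ∏ i, ∫⁻ t, f i t ∂μ := by
  intro n
  induction n with
  | zero => intro f _; simp [powM]
  | succ n ih =>
    intro f hf
    rw [Fin.prod_univ_succ, ← ih (fun i => f i.succ) fun i => hf _,
      ← lintegral_prod_mul (hf 0).aemeasurable
        (Finset.measurable_fun_prod _ fun i _ => (hf i.succ).comp (measurable_pi_apply i)).aemeasurable,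
      ← (measurePreserving_removeNth μ (0 : Fin (n + 1))).lintegral_comp]
    · simp [Fin.prod_univ_succ, Fin.removeNth]
    · exact ((hf 0).comp measurable_fst).mul (Finset.measurable_fun_prod _ fun i _ =>
        (hf i.succ).comp ((measurable_pi_apply i).comp measurable_snd))

theorem powM_withDensity (μ : Measure ℝ) [IsFiniteMeasure μ] {g : ℝ → ENNReal} (hg : Measurable g)
    [IsFiniteMeasure (μ.withDensity g)] (n : ℕ) :
    powM (μ.withDensity g) n = (powM μ n).withDensity fun x => ∏ i, g (x i) := by
  refine Measure.pi_eq fun s hs => ?_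
  rw [withDensity_apply _ (MeasurableSet.univ_pi hs), ← lintegral_indicator (MeasurableSet.univ_pi hs)]
  simp_rw [withDensity_apply _ (hs _), ← lintegral_indicator (hs _)]
  rw [← lintegral_prod_powM μ n _ fun i => hg.indicator (hs i)]
  refine lintegral_congr fun x => ?_
  by_cases h : x ∈ Set.pi Set.univ s
  · rw [Set.indicator_of_mem h]
    exact prod_congr rfl fun i _ => (Set.indicator_of_mem (h i trivial) _).symm
  · rw [Set.indicator_of_notMem h]
    simp only [Set.mem_pi, Set.mem_univ, true_implies, not_forall] at h
    obtain ⟨i, hi⟩ := h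
    exact (prod_eq_zero (mem_univ i) (Set.indicator_of_notMem hi _)).symm

theorem powM_restrict_Icc (n : ℕ) :
    powM (volume.restrict (Set.Icc (0 : ℝ) 1)) n = volume.restrict (Set.Icc (0 : Fin n → ℝ) 1) := by
  have h := Measure.restrict_pi_pi (fun _ : Fin n => (volume : Measure ℝ))
    (fun _ => Set.Icc (0 : ℝ) 1)
  rw [powM, ← h, Set.pi_univ_Icc]
  rfl

/-- The one-point weight. -/
noncomputable def wt (α δ z t : ℝ) : ℝ := t ^ α * (1 - t) ^ (δ / 2) * Real.exp (-(z * t))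

theorem wt_nonneg {α δ z t : ℝ} (ht : t ∈ Set.Icc (0 : ℝ) 1) : 0 ≤ wt α δ z t :=
  mul_nonneg (mul_nonneg (Real.rpow_nonneg ht.1 _) (Real.rpow_nonneg (by linarith [ht.2]) _))
    (Real.exp_nonneg _)

theorem wt_pos {α δ z t : ℝ} (ht : t ∈ Set.Ioo (0 : ℝ) 1) : 0 < wt α δ z t :=
  mul_pos (mul_pos (Real.rpow_pos_of_pos ht.1 _) (Real.rpow_pos_of_pos (by linarith [ht.2]) _))
    (Real.exp_pos _)

theorem measurable_wt (α δ z : ℝ) : Measurable (wt α δ z) := by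
  unfold wt; fun_prop

theorem integrableOn_wt {α δ : ℝ} (hα : -1 < α) (hδ : -2 < δ) (z : ℝ) :
    IntegrableOn (wt α δ z) (Set.Icc 0 1) := by
  have h := Complex.betaIntegral_convergent (u := (α + 1 : ℝ)) (v := (δ / 2 + 1 : ℝ))
    (by simp; linarith) (by simp; linarith)
  rw [intervalIntegrable_iff_integrableOn_Icc_of_le zero_le_one] at h
  have h0 : IntegrableOn (fun t : ℝ => t ^ α * (1 - t) ^ (δ / 2)) (Set.Icc 0 1) := by
    refine Integrable.congr h.norm ?_
    filter_upwards [ae_restrict_mem measurableSet_Icc] with t ht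
    have e1 : ((1 : ℂ) - t) = ((1 - t : ℝ) : ℂ) := by push_cast; ring
    have e2 : (((α + 1 : ℝ) : ℂ) - 1) = (α : ℂ) := by push_cast; ring
    have e3 : (((δ / 2 + 1 : ℝ) : ℂ) - 1) = ((δ / 2 : ℝ) : ℂ) := by push_cast; ring
    rw [e1, e2, e3, ← Complex.ofReal_cpow ht.1, ← Complex.ofReal_cpow (by linarith [ht.2]), norm_mul,
      Complex.norm_real, Complex.norm_real, Real.norm_of_nonneg (Real.rpow_nonneg ht.1 _),
      Real.norm_of_nonneg (Real.rpow_nonneg (by linarith [ht.2]) _)]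
  exact h0.mul_continuousOn (g' := fun t => Real.exp (-(z * t))) (by fun_prop) isCompact_Icc

/-- The tilted one-point measure. -/
noncomputable def muz (α δ z : ℝ) : Measure ℝ :=
  (volume.restrict (Set.Icc (0 : ℝ) 1)).withDensity fun t => ENNReal.ofReal (wt α δ z t)

theorem isFiniteMeasure_muz {α δ : ℝ} (hα : -1 < α) (hδ : -2 < δ) (z : ℝ) :
    IsFiniteMeasure (muz α δ z) :=
  isFiniteMeasure_withDensity_ofReal (integrableOn_wt hα hδ z).2

instance (α δ z : ℝ) : NullSingletonClass (muz α δ z) := by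
  unfold muz; infer_instance

theorem ae_muz (α δ z : ℝ) : ∀ᵐ t ∂(muz α δ z), t ∈ Set.Icc (0 : ℝ) 1 :=
  (withDensity_absolutelyContinuous _ _).ae_le (ae_restrict_mem measurableSet_Icc)

theorem muz_univ_ne_zero (α δ z : ℝ) : muz α δ z Set.univ ≠ 0 := by
  rw [muz, withDensity_apply _ MeasurableSet.univ, Measure.restrict_univ, Ne,
    lintegral_eq_zero_iff (measurable_wt α δ z).ennreal_ofReal]
  intro h
  have h2 := (ae_restrict_iff' measurableSet_Icc).1 h
  have : ∀ᵐ t : ℝ, t ∉ Set.Ioo (0 : ℝ) 1 := by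
    filter_upwards [h2] with t ht h3
    have := ht (Set.Ioo_subset_Icc_self h3)
    simp only [Pi.zero_apply, ENNReal.ofReal_eq_zero] at this
    exact (wt_pos h3).not_ge this
  rw [ae_iff] at this
  simp only [not_not, Set.ofPred_mem_eq, Real.volume_Ioo] at this
  norm_num at this

theorem integral_powM_muz {α δ : ℝ} (hα : -1 < α) (hδ : -2 < δ) (z : ℝ) (n : ℕ)
    (f : (Fin n → ℝ) → ℝ) :
    ∫ x, f x ∂(powM (muz α δ z) n)
      = ∫ x in Set.Icc (0 : Fin n → ℝ) 1, (∏ i, wt α δ z (x i)) * f x := by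
  have := isFiniteMeasure_muz hα hδ z
  unfold muz at this ⊢
  rw [powM_withDensity _ (measurable_wt α δ z).ennreal_ofReal, powM_restrict_Icc,
    integral_withDensity_eq_integral_toReal_smul]
  · refine setIntegral_congr_fun measurableSet_Icc fun x hx => ?_
    simp only [ENNReal.toReal_prod, smul_eq_mul]
    congr 1
    exact prod_congr rfl fun i _ => ENNReal.toReal_ofReal (wt_nonneg ⟨hx.1 i, hx.2 i⟩)
  · exact Finset.measurable_fun_prod _ fun i _ =>
      (measurable_wt α δ z).ennreal_ofReal.comp (measurable_pi_apply i)
  · exact ae_of_all _ fun x => ENNReal.prod_lt_top fun i _ => ENNReal.ofReal_lt_top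

theorem prod_wt (α δ z : ℝ) {n : ℕ} (x : Fin n → ℝ) :
    ∏ i, wt α δ z (x i)
      = Real.exp (∑ j, -(z * x j)) * ∏ j, x j ^ α * (1 - x j) ^ (δ / 2) := by
  rw [Real.exp_sum, ← prod_mul_distrib]
  exact prod_congr rfl fun i _ => mul_comm _ _

/-- Unnormalised expectation in the tilted Jacobi ensemble. -/
noncomputable def Ev (α δ β : ℝ) (n : ℕ) (z : ℝ) (f : (Fin n → ℝ) → ℝ) : ℝ :=
  ∫ x, f x * vand β x ∂(powM (muz α δ z) n)

theorem Ev_eq {α δ : ℝ} (hα : -1 < α) (hδ : -2 < δ) (β z : ℝ) (n : ℕ) (f : (Fin n → ℝ) → ℝ) :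
    Ev α δ β n z f = ∫ x in Set.Icc (0 : Fin n → ℝ) 1,
      Real.exp (∑ j, -(z * x j)) * f x * jacW β α δ n x := by
  rw [Ev, integral_powM_muz hα hδ]
  refine setIntegral_congr_fun measurableSet_Icc fun x _ => ?_
  simp only [prod_wt, jacW]; ring

theorem Ev_eq_zero_tilt {α δ : ℝ} (hα : -1 < α) (hδ : -2 < δ) (β z : ℝ) (n : ℕ)
    (f : (Fin n → ℝ) → ℝ) :
    Ev α δ β n z f = Ev α δ β n 0 fun x => Real.exp (-(z * psum 1 x)) * f x := by
  rw [Ev_eq hα hδ, Ev_eq hα hδ]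
  refine setIntegral_congr_fun measurableSet_Icc fun x _ => ?_
  simp [psum, mul_sum]

theorem cSel_eq {α δ : ℝ} (hα : -1 < α) (hδ : -2 < δ) (β : ℝ) (n : ℕ) :
    cSel β α δ n = Ev α δ β n 0 fun _ => 1 := by
  rw [Ev_eq hα hδ, cSel]; simp

theorem Mcond_eq {α δ : ℝ} (hα : -1 < α) (hδ : -2 < δ) (β : ℝ) (n : ℕ) (z : ℝ) :
    Mcond β α δ n z = Ev α δ β n z (fun _ => 1) / Ev α δ β n 0 fun _ => 1 := by
  rw [Mcond, cSel_eq hα hδ, Ev_eq hα hδ β z]; simp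

theorem vand_pos (β : ℝ) {n : ℕ} {x : Fin n → ℝ} (hx : Function.Injective x) : 0 < vand β x :=
  prod_pos fun _ _ => prod_pos fun _ hk => Real.rpow_pos_of_pos (abs_pos.2 (sub_ne_zero.2
    fun e => (mem_Ioi.1 hk).ne (hx e).symm)) _

theorem Ev_one_pos {α δ β : ℝ} (hα : -1 < α) (hδ : -2 < δ) (hβ : 0 ≤ β) (n : ℕ) (z : ℝ) :
    0 < Ev α δ β n z fun _ => 1 := by
  have := isFiniteMeasure_muz hα hδ z
  have hi := integrable_mul_vand (ae_muz α δ z) hβ (n := n) (f := fun _ => 1) (by fun_prop)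
  rw [Ev, integral_pos_iff_support_of_nonneg_ae
    (ae_of_all _ fun x => by simpa using vand_nonneg β x) hi]
  have h1 : (powM (muz α δ z) n) Set.univ ≠ 0 := by
    rw [powM, Measure.pi_univ]
    exact prod_ne_zero_iff.2 fun _ _ => muz_univ_ne_zero α δ z
  refine pos_iff_ne_zero.2 fun h => h1 ?_
  rw [← h]
  refine measure_congr ?_
  filter_upwards [ae_powM_injective (muz α δ z) n] with x hx
  have hx' := (vand_pos β hx).ne'
  simp only [eq_iff_iff]
  refine ⟨fun _ => ?_, fun _ => trivial⟩
  change (1 : ℝ) * vand β x ≠ 0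
  rwa [one_mul]

theorem hasDerivAt_Ev {α δ β : ℝ} (hα : -1 < α) (hδ : -2 < δ) (hβ : 0 ≤ β) (n : ℕ)
    {f : (Fin n → ℝ) → ℝ} (hf : Continuous f) (z : ℝ) :
    HasDerivAt (fun z => Ev α δ β n z f) (-Ev α δ β n z fun x => psum 1 x * f x) z := by
  have := isFiniteMeasure_muz hα hδ 0
  have hi : ∀ {g : (Fin n → ℝ) → ℝ}, Continuous g →
      Integrable (fun x => g x * vand β x) (powM (muz α δ 0) n) :=
    integrable_mul_vand (ae_muz α δ 0) hβ
  rw [funext fun w => Ev_eq_zero_tilt hα hδ β w n f, Ev_eq_zero_tilt hα hδ β z n]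
  have key := hasDerivAt_integral_of_dominated_loc_of_deriv_le (μ := powM (muz α δ 0) n)
    (F := fun z x => Real.exp (-(z * psum 1 x)) * f x * vand β x)
    (F' := fun z x => Real.exp (-(z * psum 1 x)) * (-psum 1 x) * f x * vand β x)
    (bound := fun x => Real.exp ((|z| + 1) * |psum 1 x|) * |psum 1 x| * |f x| * vand β x)
    (x₀ := z) (s := Metric.ball z 1) (Metric.ball_mem_nhds z one_pos)
    (Eventually.of_forall fun w => (hi (by fun_prop)).aestronglyMeasurable)
    (hi (by fun_prop)) (hi (by fun_prop)).aestronglyMeasurable ?_ (hi (by fun_prop)) ?_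
  · have e : (-Ev α δ β n 0 fun x => Real.exp (-(z * psum 1 x)) * (psum 1 x * f x))
        = ∫ x, Real.exp (-(z * psum 1 x)) * (-psum 1 x) * f x * vand β x
          ∂(powM (muz α δ 0) n) := by
      refine (integral_neg _).symm.trans ?_
      exact integral_congr_ae (ae_of_all _ fun x => by ring)
    rw [e]
    exact key.2
  · refine ae_of_all _ fun x w hw => ?_
    rw [norm_mul, norm_mul, norm_mul, Real.norm_of_nonneg (vand_nonneg β x), norm_neg,
      Real.norm_of_nonneg (Real.exp_nonneg _)]
    gcongr
    · exact vand_nonneg β x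
    · have h1 : |w| ≤ |z| + 1 := by
        have := abs_sub_abs_le_abs_sub w z
        have := Metric.mem_ball.1 hw
        rw [Real.dist_eq] at this
        linarith
      calc -(w * psum 1 x) ≤ |w * psum 1 x| := neg_le_abs _
        _ = |w| * |psum 1 x| := abs_mul _ _
        _ ≤ _ := by gcongr
    · exact le_rfl
    · exact le_rfl
  · refine ae_of_all _ fun x w _ => ?_
    have h : HasDerivAt (fun w => -(w * psum 1 x)) (-psum 1 x) w := by
      have := (hasDerivAt_mul_const (x := w) (psum 1 x)).neg
      exact this
    exact (h.exp.mul_const (f x)).mul_const _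

theorem contDiff_of_hasDerivAt_succ {m : ℕ → ℝ → ℝ}
    (hm : ∀ k z, HasDerivAt (m k) (-m (k + 1) z) z) (k : ℕ) : ContDiff ℝ (⊤ : ℕ∞) (m k) := by
  have h : ∀ r k : ℕ, ContDiff ℝ r (m k) := by
    intro r
    induction r with
    | zero =>
      intro k
      exact contDiff_zero.2 (continuous_iff_continuousAt.2 fun z => (hm k z).continuousAt)
    | succ r ih =>
      intro k
      rw [show ((r + 1 : ℕ) : WithTop ℕ∞) = (r : WithTop ℕ∞) + 1 by norm_cast,
        contDiff_succ_iff_deriv]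
      refine ⟨fun z => (hm k z).differentiableAt, by simp, ?_⟩
      rw [show deriv (m k) = fun z => -m (k + 1) z from funext fun z => (hm k z).deriv]
      exact (ih (k + 1)).neg
  exact contDiff_infty.2 fun r => h r k

theorem log_moment_derivs {m : ℕ → ℝ → ℝ} (hm : ∀ k z, HasDerivAt (m k) (-m (k + 1) z) z)
    (h0 : ∀ z, 0 < m 0 z) {c : ℝ} (hc : 0 < c) (z : ℝ) :
    deriv (fun z => Real.log (m 0 z / c)) z = -(m 1 z / m 0 z) ∧
    iteratedDeriv 2 (fun z => Real.log (m 0 z / c)) z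
      = (m 0 z * m 2 z - m 1 z ^ 2) / m 0 z ^ 2 ∧
    iteratedDeriv 3 (fun z => Real.log (m 0 z / c)) z
      = -((m 3 z * m 0 z ^ 2 - 3 * m 0 z * m 1 z * m 2 z + 2 * m 1 z ^ 3) / m 0 z ^ 3) ∧
    iteratedDeriv 4 (fun z => Real.log (m 0 z / c)) z
      = (m 4 z * m 0 z ^ 3 - 4 * m 3 z * m 1 z * m 0 z ^ 2 - 3 * m 2 z ^ 2 * m 0 z ^ 2
        + 12 * m 2 z * m 1 z ^ 2 * m 0 z - 6 * m 1 z ^ 4) / m 0 z ^ 4 := by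
  have d1 : deriv (fun z => Real.log (m 0 z / c)) = fun z => -(m 1 z / m 0 z) := by
    funext w
    have := h0 w
    refine (((hm 0 w).div_const c).log (by positivity)).deriv.trans ?_
    field_simp
  have d2 : iteratedDeriv 2 (fun z => Real.log (m 0 z / c))
      = fun z => (m 0 z * m 2 z - m 1 z ^ 2) / m 0 z ^ 2 := by
    rw [iteratedDeriv_succ, iteratedDeriv_one, d1]
    funext w
    have := (h0 w).ne'
    refine ((hm 1 w).div (hm 0 w) this).neg.deriv.trans ?_
    field_simp
    ring
  have d3 : iteratedDeriv 3 (fun z => Real.log (m 0 z / c)) = fun z =>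
      -((m 3 z * m 0 z ^ 2 - 3 * m 0 z * m 1 z * m 2 z + 2 * m 1 z ^ 3) / m 0 z ^ 3) := by
    rw [iteratedDeriv_succ, d2]
    funext w
    have := (h0 w).ne'
    refine ((((hm 0 w).mul (hm 2 w)).sub ((hm 1 w).pow 2)).div ((hm 0 w).pow 2)
      (pow_ne_zero 2 this)).deriv.trans ?_
    simp only [Pi.mul_apply, Pi.pow_apply, Pi.sub_apply]
    field_simp
    push_cast
    ring
  refine ⟨congrFun d1 z, congrFun d2 z, congrFun d3 z, ?_⟩
  rw [iteratedDeriv_succ, d3]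
  have := (h0 z).ne'
  refine ((((((hm 3 z).mul ((hm 0 z).pow 2)).sub ((((hm 0 z).const_mul 3).mul (hm 1 z)).mul
    (hm 2 z))).add (((hm 1 z).pow 3).const_mul 2)).div ((hm 0 z).pow 3)
      (pow_ne_zero 3 this)).neg).deriv.trans ?_
  simp only [Pi.mul_apply, Pi.pow_apply, Pi.sub_apply, Pi.add_apply]
  field_simp
  push_cast
  ring

theorem hasDerivAt_Ev_pow {α δ β : ℝ} (hα : -1 < α) (hδ : -2 < δ) (hβ : 0 ≤ β) (n k : ℕ) (z : ℝ) :
    HasDerivAt (fun z => Ev α δ β n z fun x => psum 1 x ^ k)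
      (-Ev α δ β n z fun x => psum 1 x ^ (k + 1)) z := by
  simp only [pow_succ']
  exact hasDerivAt_Ev hα hδ hβ n (by fun_prop) z

theorem sigCond_eq {α δ : ℝ} (hα : -1 < α) (hδ : -2 < δ) (β : ℝ) (n : ℕ) :
    sigCond β α δ n = fun z =>
      Real.log (Ev α δ β n z (fun x => psum 1 x ^ 0) / Ev α δ β n 0 fun _ => 1) := by
  funext z
  simp [sigCond, Mcond_eq hα hδ]

theorem contDiff_sigCond {α δ β : ℝ} (hα : -1 < α) (hδ : -2 < δ) (hβ : 0 ≤ β) (n : ℕ) :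
    ContDiff ℝ (⊤ : ℕ∞) (sigCond β α δ n) := by
  rw [sigCond_eq hα hδ]
  refine ContDiff.log ?_ fun z => ?_
  · exact (contDiff_of_hasDerivAt_succ (m := fun k z => Ev α δ β n z fun x => psum 1 x ^ k)
      (hasDerivAt_Ev_pow hα hδ hβ n) 0).div_const _
  · have h1 := Ev_one_pos hα hδ hβ n z
    have h2 := Ev_one_pos hα hδ hβ n 0
    simp only [pow_zero]
    positivity

theorem two_mul_sum_div_sub {m : ℕ} {y : Fin (m + 1) → ℝ} (hy : Function.Injective y)
    {f : ℝ → ℝ} {h : ℝ → ℝ → ℝ} (hf : ∀ a b, f a - f b = h a b * (a - b)) :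
    2 * ∑ k, f (y k) * ∑ l, (y k - k.removeNth y l)⁻¹
      = (∑ k, ∑ l, h (y k) (y l)) - ∑ k, h (y k) (y k) := by
  have e1 : ∑ k, f (y k) * ∑ l, (y k - k.removeNth y l)⁻¹
      = ∑ k, ∑ l, f (y k) * (y k - y l)⁻¹ := by
    refine sum_congr rfl fun k _ => ?_
    rw [← mul_sum, Fin.sum_univ_succAbove _ k]
    simp [Fin.removeNth]
  have e2 : ∑ k, ∑ l, f (y k) * (y k - y l)⁻¹ = -∑ k, ∑ l, f (y l) * (y k - y l)⁻¹ := by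
    rw [sum_comm, ← sum_neg_distrib]
    refine sum_congr rfl fun k _ => ?_
    rw [← sum_neg_distrib]
    refine sum_congr rfl fun l _ => ?_
    rw [← neg_sub (y k) (y l), inv_neg]; ring
  rw [two_mul, e1]
  nth_rw 2 [e2]
  rw [← sub_eq_add_neg, ← sum_sub_distrib, ← sum_sub_distrib]
  refine sum_congr rfl fun k _ => ?_
  rw [← sum_sub_distrib, Fin.sum_univ_succAbove _ k, Fin.sum_univ_succAbove _ k]
  have : ∀ l, f (y k) * (y k - y (k.succAbove l))⁻¹ - f (y (k.succAbove l)) *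
      (y k - y (k.succAbove l))⁻¹ = h (y k) (y (k.succAbove l)) := fun l => by
    have : y k - y (k.succAbove l) ≠ 0 := sub_ne_zero.2 fun e => Fin.succAbove_ne k l (hy e).symm
    rw [← sub_mul, hf]
    field_simp
  simp [this]

theorem sum_mul_inv_sub_low {m : ℕ} {y : Fin (m + 1) → ℝ} (hy : Function.Injective y) :
    ∑ k, (y k * (1 - y k)) * ∑ l, (y k - k.removeNth y l)⁻¹ = (m + 1) * m / 2 - m * psum 1 y := by
  have := two_mul_sum_div_sub hy (f := fun t => t * (1 - t)) (h := fun a b => 1 - a - b)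
    fun a b => by ring
  simp only [sum_sub_distrib, sum_const, card_univ, Fintype.card_fin, nsmul_eq_mul,
    ← mul_sum] at this
  push_cast at this
  rw [psum_one]
  linarith

theorem sum_mul_inv_sub_high {m : ℕ} {y : Fin (m + 1) → ℝ} (hy : Function.Injective y) :
    ∑ k, (y k ^ 2 * (1 - y k)) * ∑ l, (y k - k.removeNth y l)⁻¹
      = m * psum 1 y - m * psum 2 y - (psum 1 y ^ 2 - psum 2 y) / 2 := by
  have := two_mul_sum_div_sub hy (f := fun t => t ^ 2 * (1 - t))
    (h := fun a b => a + b - (a ^ 2 + a * b + b ^ 2)) fun a b => by ring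
  simp only [sum_sub_distrib, sum_add_distrib, sum_const, card_univ, Fintype.card_fin,
    nsmul_eq_mul, ← mul_sum, ← sum_mul, ← sq] at this
  push_cast at this
  rw [psum_one, psum_two]
  linarith

/-- The interaction of a point with a configuration. -/
noncomputable def inter (β t : ℝ) {n : ℕ} (v : Fin n → ℝ) : ℝ := ∏ l, |v l - t| ^ β

theorem continuous_inter {β : ℝ} (hβ : 0 ≤ β) (n : ℕ) :
    Continuous fun w : ℝ × (Fin n → ℝ) => inter β w.1 w.2 := by
  unfold inter
  exact continuous_finsetProd _ fun l _ => Continuous.rpow_const (by fun_prop) fun _ => Or.inr hβ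

theorem abs_inter_mul_inv_le {β : ℝ} (t : ℝ) {n : ℕ} (v : Fin n → ℝ) (l : Fin n) :
    |inter β t v * (t - v l)⁻¹| ≤ |v l - t| ^ (β - 1) * ∏ j ∈ univ.erase l, |v j - t| ^ β := by
  rw [inter, ← mul_prod_erase univ _ (mem_univ l)]
  have hP : 0 ≤ ∏ j ∈ univ.erase l, |v j - t| ^ β :=
    prod_nonneg fun _ _ => Real.rpow_nonneg (abs_nonneg _) _
  rw [abs_mul, abs_mul, abs_of_nonneg hP, abs_of_nonneg (Real.rpow_nonneg (abs_nonneg _) _),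
    abs_inv, abs_sub_comm t]
  rcases eq_or_ne (|v l - t|) 0 with h | h
  · rw [h]
    simp only [inv_zero, mul_zero]
    positivity
  · rw [Real.rpow_sub_one h]
    exact le_of_eq (by ring)

theorem hasDerivAt_prod_of_logDeriv {ι : Type*} (s : Finset ι) {f : ι → ℝ → ℝ} {g : ι → ℝ} {t : ℝ}
    (h : ∀ i ∈ s, HasDerivAt (f i) (f i t * g i) t) :
    HasDerivAt (fun t => ∏ i ∈ s, f i t) ((∏ i ∈ s, f i t) * ∑ i ∈ s, g i) t := by
  classical
  induction s using Finset.induction_on with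
  | empty => simpa using hasDerivAt_const t (1 : ℝ)
  | insert a s ha ih =>
    simp only [prod_insert ha, sum_insert ha]
    have h1 := h a (mem_insert_self _ _)
    have h2 := ih fun i hi => h i (mem_insert_of_mem hi)
    have h3 := h1.mul h2
    refine h3.congr_deriv ?_
    ring

theorem hasDerivAt_abs_sub_rpow (β : ℝ) {v t : ℝ} (h : v ≠ t) :
    HasDerivAt (fun t => |v - t| ^ β) (|v - t| ^ β * (β * (t - v)⁻¹)) t := by
  have h0 : |v - t| ≠ 0 := abs_ne_zero.2 (sub_ne_zero.2 h)
  have h2 : v - t ≠ 0 := sub_ne_zero.2 h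
  have h3 : t - v ≠ 0 := sub_ne_zero.2 h.symm
  have h1 : HasDerivAt (fun t => |v - t|) (|v - t| * (t - v)⁻¹) t := by
    rcases lt_or_gt_of_ne h with hlt | hgt
    · have : (fun s => |v - s|) =ᶠ[nhds t] fun s => s - v := by
        filter_upwards [lt_mem_nhds hlt] with s hs
        rw [abs_sub_comm, abs_of_pos (sub_pos.2 hs)]
      refine (((hasDerivAt_id t).sub_const v).congr_of_eventuallyEq this).congr_deriv ?_
      rw [abs_sub_comm, abs_of_pos (sub_pos.2 hlt), mul_inv_cancel₀ h3]
    · have : (fun s => |v - s|) =ᶠ[nhds t] fun s => v - s := by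
        filter_upwards [gt_mem_nhds hgt] with s hs
        rw [abs_of_pos (sub_pos.2 hs)]
      refine (((hasDerivAt_id t).const_sub v).congr_of_eventuallyEq this).congr_deriv ?_
      rw [abs_of_pos (sub_pos.2 hgt), ← neg_sub v t]
      field_simp
  refine (h1.rpow_const (Or.inl h0)).congr_deriv ?_
  rw [Real.rpow_sub_one h0]
  field_simp

theorem hasDerivAt_inter (β : ℝ) {t : ℝ} {n : ℕ} {v : Fin n → ℝ} (h : ∀ l, v l ≠ t) :
    HasDerivAt (fun t => inter β t v) (inter β t v * ∑ l, β * (t - v l)⁻¹) t :=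
  hasDerivAt_prod_of_logDeriv univ fun l _ => hasDerivAt_abs_sub_rpow β (h l)

/-- The total derivative whose integral against the one-point weight vanishes. -/
noncomputable def loopD (α δ β z t : ℝ) {n : ℕ} (v : Fin n → ℝ) (b b' : ℝ) : ℝ :=
  inter β t v * ((α + 1) * (1 - t) * b - (δ / 2 + 1) * t * b - z * (t * (1 - t)) * b
      + t * (1 - t) * b')
    + t * (1 - t) * b * β * ∑ l, inter β t v * (t - v l)⁻¹

theorem hasDerivAt_loop {α δ β z t : ℝ} (ht : t ∈ Set.Ioo (0 : ℝ) 1) {n : ℕ} {v : Fin n → ℝ}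
    (h : ∀ l, v l ≠ t) {b : ℝ → ℝ} {b' : ℝ} (hb : HasDerivAt b b' t) :
    HasDerivAt (fun t => t ^ (α + 1) * (1 - t) ^ (δ / 2 + 1) * Real.exp (-(z * t)) * b t *
      inter β t v) (wt α δ z t * loopD α δ β z t v (b t) b') t := by
  have ht0 : t ≠ 0 := ht.1.ne'
  have ht1 : 1 - t ≠ 0 := (sub_pos.2 ht.2).ne'
  have h1 := Real.hasDerivAt_rpow_const (p := α + 1) (Or.inl ht0)
  have h2 := ((hasDerivAt_id t).const_sub 1).rpow_const (p := δ / 2 + 1) (Or.inl ht1)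
  have h3 : HasDerivAt (fun t => Real.exp (-(z * t))) (Real.exp (-(z * t)) * -z) t := by
    have := ((hasDerivAt_id t).const_mul z).neg.exp
    simpa using this
  refine ((((h1.mul h2).mul h3).mul hb).mul (hasDerivAt_inter β h)).congr_deriv ?_
  simp only [wt, loopD, Pi.mul_apply, id, add_sub_cancel_right, ← mul_sum]
  rw [Real.rpow_add_one ht0, Real.rpow_add_one ht1]
  ring

/-- A continuous majorant of `loopD`. -/
noncomputable def loopG (α δ β z t : ℝ) {n : ℕ} (v : Fin n → ℝ) (b b' : ℝ) : ℝ :=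
  |inter β t v * ((α + 1) * (1 - t) * b - (δ / 2 + 1) * t * b - z * (t * (1 - t)) * b
      + t * (1 - t) * b')|
    + |t * (1 - t) * b * β| * ∑ l, |v l - t| ^ (β - 1) * ∏ j ∈ univ.erase l, |v j - t| ^ β

theorem abs_loopD_le (α δ β z t : ℝ) {n : ℕ} (v : Fin n → ℝ) (b b' : ℝ) :
    |loopD α δ β z t v b b'| ≤ loopG α δ β z t v b b' := by
  refine (abs_add_le _ _).trans ?_
  rw [loopG, abs_mul (t * (1 - t) * b * β)]
  gcongr
  exact (abs_sum_le_sum_abs _ _).trans (sum_le_sum fun l _ => abs_inter_mul_inv_le t v l)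

theorem integrable_loopD {X : Type*} [TopologicalSpace X] [MeasurableSpace X] [BorelSpace X]
    {ν : Measure X} [IsFiniteMeasure ν] {K : Set X} (hK : IsCompact K) (hν : ∀ᵐ x ∂ν, x ∈ K)
    {α δ β z : ℝ} (hβ : 1 ≤ β) {n : ℕ} {t b b' g : X → ℝ} {v : X → Fin n → ℝ} (ht : Continuous t)
    (hv : Continuous v) (hb : Continuous b) (hb' : Continuous b') (hg : Continuous g) :
    Integrable (fun x => loopD α δ β z (t x) (v x) (b x) (b' x) * g x) ν := by
  have hvl : ∀ l, Continuous fun x => v x l := fun l => (continuous_apply l).comp hv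
  have hi : Continuous fun x => inter β (t x) (v x) :=
    (continuous_inter (by linarith : 0 ≤ β) n).comp (ht.prodMk hv)
  refine integrable_of_abs_le_continuous hK hν
    (g := fun x => loopG α δ β z (t x) (v x) (b x) (b' x) * g x) ?_ ?_ fun x => ?_
  · have h1 : ∀ l, Measurable fun x => (t x - v x l)⁻¹ := fun l =>
      ((ht.sub (hvl l)).measurable).inv
    have h2 : Measurable fun x => ∑ l, inter β (t x) (v x) * (t x - v x l)⁻¹ :=
      Finset.measurable_fun_sum _ fun l _ => hi.measurable.mul (h1 l)
    have h3 : Continuous fun x => inter β (t x) (v x) * ((α + 1) * (1 - t x) * b x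
        - (δ / 2 + 1) * t x * b x - z * (t x * (1 - t x)) * b x + t x * (1 - t x) * b' x) := by
      fun_prop
    have h4 : Continuous fun x => t x * (1 - t x) * b x * β := by fun_prop
    exact (h3.measurable.add (h4.measurable.mul h2)).mul hg.measurable
  · have h5 : Continuous fun x => ∑ l, |v x l - t x| ^ (β - 1) *
        ∏ j ∈ univ.erase l, |v x j - t x| ^ β := by
      refine continuous_finsetSum _ fun l _ => Continuous.mul ?_ ?_
      · exact (((hvl l).sub ht).abs).rpow_const fun _ => Or.inr (by linarith)
      · exact continuous_finsetProd _ fun j _ =>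
          (((hvl j).sub ht).abs).rpow_const fun _ => Or.inr (by linarith)
    unfold loopG
    fun_prop
  · rw [abs_mul, abs_mul]
    exact mul_le_mul_of_nonneg_right ((abs_loopD_le _ _ _ _ _ _ _ _).trans (le_abs_self _))
      (abs_nonneg _)

theorem integral_muz {α δ z : ℝ} (f : ℝ → ℝ) :
    ∫ t, f t ∂(muz α δ z) = ∫ t in Set.Icc (0 : ℝ) 1, wt α δ z t * f t := by
  rw [muz, integral_withDensity_eq_integral_toReal_smul (measurable_wt α δ z).ennreal_ofReal
    (ae_of_all _ fun _ => ENNReal.ofReal_lt_top)]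
  refine setIntegral_congr_fun measurableSet_Icc fun t ht => ?_
  simp only [smul_eq_mul]
  rw [ENNReal.toReal_ofReal (wt_nonneg ht)]

theorem integrable_muz {α δ z : ℝ} {f : ℝ → ℝ} (hf : Integrable f (muz α δ z)) :
    IntegrableOn (fun t => wt α δ z t * f t) (Set.Icc 0 1) := by
  rw [muz, integrable_withDensity_iff_integrable_smul' (measurable_wt α δ z).ennreal_ofReal
    (ae_of_all _ fun _ => ENNReal.ofReal_lt_top)] at hf
  refine hf.congr ?_
  filter_upwards [ae_restrict_mem measurableSet_Icc] with t ht
  rw [ENNReal.toReal_ofReal (wt_nonneg ht), smul_eq_mul]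

theorem integral_loopD {α δ β : ℝ} (hα : -1 < α) (hδ : -2 < δ) (hβ : 1 ≤ β) (z : ℝ) {n : ℕ}
    (v : Fin n → ℝ) {b b' : ℝ → ℝ} (hb : ∀ t, HasDerivAt b (b' t) t) (hb' : Continuous b') :
    ∫ t, loopD α δ β z t v (b t) (b' t) ∂(muz α δ z) = 0 := by
  have := isFiniteMeasure_muz hα hδ z
  have hbc : Continuous b := continuous_iff_continuousAt.2 fun t => (hb t).continuousAt
  have hI := integrable_loopD isCompact_Icc (ae_muz α δ z) (α := α) (δ := δ) (z := z) hβ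
    continuous_id (continuous_const (y := v)) hbc hb' (continuous_const (y := 1))
  simp only [id, mul_one] at hI
  rw [integral_muz, integral_Icc_eq_integral_Ioc, ← intervalIntegral.integral_of_le zero_le_one,
    integral_eq_of_hasDerivAt_off_countable_of_le
      (fun t => t ^ (α + 1) * (1 - t) ^ (δ / 2 + 1) * Real.exp (-(z * t)) * b t * inter β t v)
      _ zero_le_one (s := Set.range v) (Set.countable_range v)]
  · simp [Real.zero_rpow (by linarith : α + 1 ≠ 0), Real.zero_rpow (by linarith : δ / 2 + 1 ≠ 0)]
  · have h1 : Continuous fun t : ℝ => t ^ (α + 1) :=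
      Real.continuous_rpow_const (by linarith)
    have h2 : Continuous fun t : ℝ => (1 - t) ^ (δ / 2 + 1) :=
      (continuous_const.sub continuous_id).rpow_const fun _ => Or.inr (by linarith)
    have h3 : Continuous fun t : ℝ => inter β t v :=
      (continuous_inter (by linarith : 0 ≤ β) n).comp (continuous_id.prodMk continuous_const)
    exact Continuous.continuousOn (by fun_prop)
  · exact fun t ht => hasDerivAt_loop ht.1 (fun l h => ht.2 ⟨l, h⟩) (hb t)
  · rw [intervalIntegrable_iff_integrableOn_Icc_of_le zero_le_one]
    exact integrable_muz hI

theorem natCast_mul_pow_pred_mul (e : ℕ) (t : ℝ) : e * t ^ (e - 1) * t = e * t ^ e := by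
  cases e with
  | zero => simp
  | succ e => rw [Nat.add_sub_cancel, pow_succ]; ring

theorem loop_equation {α δ β : ℝ} (hα : -1 < α) (hδ : -2 < δ) (hβ : 1 ≤ β) (z : ℝ) (m e r : ℕ)
    {S : (Fin (m + 1) → ℝ) → ℝ} (hS : ∀ y, Function.Injective y →
      ∑ k, (y k ^ (e + 1) * (1 - y k)) * ∑ l, (y k - k.removeNth y l)⁻¹ = S y) :
    Ev α δ β (m + 1) z (fun y => psum r y * ((α + 1) * (psum e y - psum (e + 1) y)
      - (δ / 2 + 1) * psum (e + 1) y - z * (psum (e + 1) y - psum (e + 2) y)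
      + e * (psum e y - psum (e + 1) y) + β * S y)
      + r * (psum (e + r) y - psum (e + r + 1) y)) = 0 := by
  have := isFiniteMeasure_muz hα hδ z
  set μ := muz α δ z with hμ
  let b : ℝ → (Fin m → ℝ) → ℝ := fun t v => t ^ e * (t ^ r + psum r v)
  let b' : ℝ → (Fin m → ℝ) → ℝ := fun t v =>
    (e * t ^ (e - 1)) * (t ^ r + psum r v) + t ^ e * (r * t ^ (r - 1))
  let H : ℝ × (Fin m → ℝ) → ℝ := fun w => loopD α δ β z w.1 w.2 (b w.1 w.2) (b' w.1 w.2) * vand β w.2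
  have hH : Integrable H (μ.prod (powM μ m)) :=
    integrable_loopD (isCompact_Icc.prod isCompact_Icc)
      (ae_prod_mem (ae_muz α δ z) (ae_powM_mem_Icc (ae_muz α δ z) m)) hβ continuous_fst
      continuous_snd (by fun_prop) (by fun_prop)
      ((continuous_vand (by linarith) m).comp continuous_snd)
  have h0 : ∫ w, H w ∂(μ.prod (powM μ m)) = 0 := by
    rw [integral_prod_symm _ hH]
    refine integral_eq_zero_of_ae (ae_of_all _ fun v => ?_)
    simp only [H, integral_mul_const, Pi.zero_apply]
    rw [integral_loopD hα hδ hβ z v (b := fun t => b t v) (b' := fun t => b' t v), zero_mul]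
    · exact fun t => (hasDerivAt_pow e t).mul ((hasDerivAt_pow r t).add_const _)
    · fun_prop
  have h1 : ∫ y, ∑ k, H (y k, k.removeNth y) ∂(powM μ (m + 1)) = 0 := by
    refine (integral_finsetSum _ fun k _ =>
      (measurePreserving_removeNth μ k).integrable_comp_of_integrable hH).trans ?_
    exact sum_eq_zero fun k _ =>
      ((measurePreserving_removeNth μ k).integral_comp_of_integrable hH).trans h0
  rw [Ev, ← h1]
  refine integral_congr_ae ?_
  filter_upwards [ae_powM_injective μ (m + 1)] with y hy
  have hp : ∀ k : Fin (m + 1), y k ^ r + psum r (k.removeNth y) = psum r y := fun k => by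
    rw [psum_removeNth]; ring
  have hk : ∀ k : Fin (m + 1), H (y k, k.removeNth y) = vand β y * (psum r y *
      ((α + 1) * (y k ^ e - y k ^ (e + 1)) - (δ / 2 + 1) * y k ^ (e + 1)
        - z * (y k ^ (e + 1) - y k ^ (e + 2)) + e * (y k ^ e - y k ^ (e + 1))
        + β * ((y k ^ (e + 1) * (1 - y k)) * ∑ l, (y k - k.removeNth y l)⁻¹))
        + r * (y k ^ (e + r) - y k ^ (e + r + 1))) := fun k => by
    simp only [H, b, b', loopD, hp, ← mul_sum]
    rw [vand_eq_removeNth β y k]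
    change _ = vand β (k.removeNth y) * inter β (y k) (k.removeNth y) * _
    have e1 := natCast_mul_pow_pred_mul e (y k)
    have e2 := natCast_mul_pow_pred_mul r (y k)
    generalize inter β (y k) (k.removeNth y) = I
    generalize vand β (k.removeNth y) = V
    generalize ∑ l, (y k - k.removeNth y l)⁻¹ = Q
    simp only [pow_add, pow_one, pow_two]
    linear_combination V * I * (1 - y k) * psum r y * e1 + V * I * (1 - y k) * y k ^ e * e2
  simp only [hk, ← hS y hy, ← mul_sum]
  rw [mul_comm]
  congr 1
  simp only [sum_add_distrib, sum_sub_distrib, ← mul_sum, psum]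

theorem Ev_linear {α δ β : ℝ} (hα : -1 < α) (hδ : -2 < δ) (hβ : 0 ≤ β) (n : ℕ) (z : ℝ)
    {k : ℕ} (a : Fin k → ℝ) {f : Fin k → (Fin n → ℝ) → ℝ} (hf : ∀ i, Continuous (f i)) :
    Ev α δ β n z (fun x => ∑ i, a i * f i x) = ∑ i, a i * Ev α δ β n z (f i) := by
  have := isFiniteMeasure_muz hα hδ z
  simp only [Ev, sum_mul, mul_assoc]
  rw [integral_finsetSum _ fun i _ =>
    (integrable_mul_vand (ae_muz α δ z) hβ (hf i)).const_mul (a i)]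
  simp only [integral_const_mul]

/-- The polynomials in power sums that occur in the lowest loop equations. -/
noncomputable def powerSumMonomial {n : ℕ} : Fin 9 → (Fin n → ℝ) → ℝ :=
  ![fun x => psum 1 x ^ 0, fun x => psum 1 x ^ 1, fun x => psum 1 x ^ 2, fun x => psum 1 x ^ 3,
    psum 2, fun x => psum 1 x * psum 2 x, fun x => psum 2 x ^ 2, psum 3,
    fun x => psum 1 x * psum 3 x]

theorem continuous_powerSumMonomial {n : ℕ} (i : Fin 9) :
    Continuous (powerSumMonomial (n := n) i) := by
  fin_cases i <;> simp [powerSumMonomial] <;> fun_prop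

theorem Ev_powerSum {α δ β : ℝ} (hα : -1 < α) (hδ : -2 < δ) (hβ : 0 ≤ β) {n : ℕ} {z : ℝ}
    {f : (Fin n → ℝ) → ℝ} (hE : Ev α δ β n z f = 0) (a : Fin 9 → ℝ)
    (h : ∀ x, f x = a 0 + a 1 * psum 1 x + a 2 * psum 1 x ^ 2 + a 3 * psum 1 x ^ 3
      + a 4 * psum 2 x + a 5 * (psum 1 x * psum 2 x) + a 6 * psum 2 x ^ 2 + a 7 * psum 3 x
      + a 8 * (psum 1 x * psum 3 x)) :
    a 0 * Ev α δ β n z (fun x => psum 1 x ^ 0) + a 1 * Ev α δ β n z (fun x => psum 1 x ^ 1)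
      + a 2 * Ev α δ β n z (fun x => psum 1 x ^ 2) + a 3 * Ev α δ β n z (fun x => psum 1 x ^ 3)
      + a 4 * Ev α δ β n z (psum 2) + a 5 * Ev α δ β n z (fun x => psum 1 x * psum 2 x)
      + a 6 * Ev α δ β n z (fun x => psum 2 x ^ 2) + a 7 * Ev α δ β n z (psum 3)
      + a 8 * Ev α δ β n z (fun x => psum 1 x * psum 3 x) = 0 := by
  have h1 := Ev_linear hα hδ hβ n z a continuous_powerSumMonomial
  have h2 : f = fun x => ∑ i, a i * powerSumMonomial i x := by
    funext x
    rw [h]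
    simp [Fin.sum_univ_succ, powerSumMonomial]
    ring!
  rw [← h2, hE] at h1
  rw [h1]
  simp only [Fin.sum_univ_succ, powerSumMonomial]
  simp
  ring!

theorem psum_zero {n : ℕ} (x : Fin n → ℝ) : psum 0 x = n := by simp [psum]

theorem moment_relations {α δ β : ℝ} (hα : -1 < α) (hδ : -2 < δ) (hβ : 1 ≤ β) (z : ℝ) (n : ℕ)
    {m0 m1 m2 m3 P2 P3 P12 P22 P13 : ℝ}
    (h0 : m0 = Ev α δ β (n + 1) z fun x => psum 1 x ^ 0)
    (h1 : m1 = Ev α δ β (n + 1) z fun x => psum 1 x ^ 1)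
    (h2 : m2 = Ev α δ β (n + 1) z fun x => psum 1 x ^ 2)
    (h3 : m3 = Ev α δ β (n + 1) z fun x => psum 1 x ^ 3)
    (hP2 : P2 = Ev α δ β (n + 1) z (psum 2)) (hP3 : P3 = Ev α δ β (n + 1) z (psum 3))
    (hP12 : P12 = Ev α δ β (n + 1) z fun x => psum 1 x * psum 2 x)
    (hP22 : P22 = Ev α δ β (n + 1) z fun x => psum 2 x ^ 2)
    (hP13 : P13 = Ev α δ β (n + 1) z fun x => psum 1 x * psum 3 x)
    {c0 c1 : ℝ} (hc0 : c0 = (n + 1) * (1 + α + β * n / 2))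
    (hc1 : c1 = 2 + α + δ / 2 + β * n) :
    c0 * m0 - (c1 + z) * m1 + z * P2 = 0 ∧
    c0 * m1 - (c1 + z) * m2 + z * P12 + (m1 - P2) = 0 ∧
    c0 * P2 - (c1 + z) * P12 + z * P22 + 2 * (P2 - P3) = 0 ∧
    (α + 1) * (m1 - P2) - (δ / 2 + 1) * P2 - z * (P2 - P3) + (m1 - P2)
      + β * (n * m1 - n * P2 - (m2 - P2) / 2) = 0 ∧
    (α + 2) * (m2 - P12) - (δ / 2 + 1) * P12 - z * (P12 - P13)
      + β * (n * m2 - n * P12 - (m3 - P12) / 2) + (P2 - P3) = 0 := by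
  have hβ0 : 0 ≤ β := by linarith
  have low := fun r => loop_equation hα hδ hβ z n 0 r
    (S := fun y => (n + 1) * n / 2 - n * psum 1 y) fun y hy => by
      simpa using sum_mul_inv_sub_low hy
  have high := fun r => loop_equation hα hδ hβ z n 1 r
    (S := fun y => n * psum 1 y - n * psum 2 y - (psum 1 y ^ 2 - psum 2 y) / 2) fun y hy => by
      simpa using sum_mul_inv_sub_high hy
  have hn : (n : ℝ) + 1 ≠ 0 := by positivity
  have A := Ev_powerSum hα hδ hβ0 (low 0) ((n + 1 : ℝ) • ![c0, -(c1 + z), 0, 0, z, 0, 0, 0, 0])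
    fun x => by simp [psum_zero]; rw [hc0, hc1]; ring
  have B := Ev_powerSum hα hδ hβ0 (low 1) ![0, c0 + 1, -(c1 + z), 0, -1, z, 0, 0, 0]
    fun x => by simp [psum_zero]; rw [hc0, hc1]; ring
  have C := Ev_powerSum hα hδ hβ0 (low 2) ![0, 0, 0, 0, c0 + 2, -(c1 + z), z, -2, 0]
    fun x => by simp [psum_zero]; rw [hc0, hc1]; ring
  have D := Ev_powerSum hα hδ hβ0 (high 0) ((n + 1 : ℝ) • ![0, α + 2 + β * n, -(β / 2), 0,
    -(α + 2) - (δ / 2 + 1) - z - β * n + β / 2, 0, 0, z, 0])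
    fun x => by simp [psum_zero]; ring
  have E := Ev_powerSum hα hδ hβ0 (high 1) ![0, 0, α + 2 + β * n, -(β / 2), 1,
    -(α + 2) - (δ / 2 + 1) - z - β * n + β / 2, 0, -1, z]
    fun x => by simp; ring
  simp only [← h0, ← h1, ← h2, ← h3, ← hP2, ← hP3, ← hP12, ← hP22, ← hP13] at A B C D E
  simp at A B C D E
  refine ⟨mul_left_cancel₀ hn ?_, ?_, ?_, mul_left_cancel₀ hn ?_, ?_⟩
  · linear_combination A
  · linear_combination B
  · linear_combination C
  · linear_combination D
  · linear_combination E

theorem loop_elimination {α β d z n m1 m2 m3 P2 P3 P12 P22 P13 c0 c1 : ℝ}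
    (hc0 : c0 = (n + 1) * (1 + α + β * n / 2)) (hc1 : c1 = 2 + α + d + β * n)
    (r00 : c0 - (c1 + z) * m1 + z * P2 = 0)
    (r01 : c0 * m1 - (c1 + z) * m2 + z * P12 + (m1 - P2) = 0)
    (r02 : c0 * P2 - (c1 + z) * P12 + z * P22 + 2 * (P2 - P3) = 0)
    (r10 : (α + 1) * (m1 - P2) - (d + 1) * P2 - z * (P2 - P3) + (m1 - P2)
      + β * (n * m1 - n * P2 - (m2 - P2) / 2) = 0)
    (r11 : (α + 2) * (m2 - P12) - (d + 1) * P12 - z * (P12 - P13)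
      + β * (n * m2 - n * P12 - (m3 - P12) / 2) + (P2 - P3) = 0) :
    β * (2 * z ^ 2 * -(m3 - 3 * m1 * m2 + 2 * m1 ^ 3) + z * (-m1) ^ 2
        + 4 * z ^ 2 * -m1 * (m2 - m1 ^ 2))
      + ((-z ^ 3 + 2 * (β * (n + 1) + α - d) * z ^ 2
            - (β * (n + 1) + α + d + 6 - 3 * β) * (β * (n + 1) + α + d + 2 - β) * z + β * z)
              * (m2 - m1 ^ 2)
          + ((β * (n + 1) + α - d) * z
            - (β * (n + 1) + α + d) * (β * (n + 1) + α + d + 2 - β)) * -m1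
          + (-((n + 1) / 2) * (β * (n + 1) + 2 * α + 2 - β) * (β * (n + 1) + d + α - z)))
      = z ^ 3 * (3 * (P22 - P2 ^ 2) - 4 * (P13 - m1 * P3)) := by
  subst hc0 hc1
  set c0 := (n + 1) * (1 + α + β * n / 2) with hc0
  set c1 := 2 + α + d + β * n with hc1
  linear_combination (exp := 1) -(3 * z ^ 2 * r02 - 4 * z ^ 2 * r11
    + z * (3 * (c1 + z) - 4 * (c1 + 1 + z - β / 2)) * r01
    + (4 * z ^ 2 * m1 + 2 * z) * r10
    + (-3 * z ^ 2 * P2 - 3 * z * (c0 + 2) + 4 * z + (3 * (c1 + z) - 4 * (c1 + 1 + z - β / 2))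
      + (4 * z * m1 + 2) * (c1 + 1 + z - β / 2) + 3 * z * (c0 - (c1 + z) * m1)) * r00)

theorem cgf_ode_kpInt {α δ β : ℝ} (hα : -1 < α) (hδ : -2 < δ) (hβ : 1 ≤ β) (z : ℝ) (n : ℕ) {c : ℝ}
    (hc : c ≠ 0) :
    c ^ 2 * z ^ 3 * iteratedDeriv 4 (sigCond β α δ (n + 1)) z
        + 6 * c ^ 2 * z ^ 3 * (iteratedDeriv 2 (sigCond β α δ (n + 1)) z) ^ 2
        + β * (2 * z ^ 2 * iteratedDeriv 3 (sigCond β α δ (n + 1)) z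
            + z * (deriv (sigCond β α δ (n + 1)) z) ^ 2
            + 4 * z ^ 2 * deriv (sigCond β α δ (n + 1)) z
              * iteratedDeriv 2 (sigCond β α δ (n + 1)) z)
        + ((-z ^ 3 + 2 * (β * (n + 1) + α - δ / 2) * z ^ 2
              - (β * (n + 1) + α + δ / 2 + 6 - 3 * β) * (β * (n + 1) + α + δ / 2 + 2 - β) * z
              + β * z) * iteratedDeriv 2 (sigCond β α δ (n + 1)) z
            + ((β * (n + 1) + α - δ / 2) * z
                - (β * (n + 1) + α + δ / 2) * (β * (n + 1) + α + δ / 2 + 2 - β)) *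
                deriv (sigCond β α δ (n + 1)) z
            + (-(((n : ℝ) + 1) / 2) * (β * (n + 1) + 2 * α + 2 - β)
              * (β * (n + 1) + δ / 2 + α - z)))
      = z ^ 3 * (12 * kpInt (muz α δ z) β c (n + 1)
          / (c ^ 2 * (Ev α δ β (n + 1) z fun _ => 1) ^ 2)) := by
  have := isFiniteMeasure_muz hα hδ z
  have hβ0 : 0 ≤ β := by linarith
  have hpos : ∀ w, 0 < Ev α δ β (n + 1) w fun x => psum 1 x ^ 0 := fun w => by
    simpa using Ev_one_pos hα hδ hβ0 (n + 1) w
  obtain ⟨d1, d2, d3, d4⟩ := log_moment_derivs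
    (m := fun k z => Ev α δ β (n + 1) z fun x => psum 1 x ^ k)
    (hasDerivAt_Ev_pow hα hδ hβ0 (n + 1)) hpos (Ev_one_pos hα hδ hβ0 (n + 1) 0) z
  rw [sigCond_eq hα hδ, d1, d2, d3, d4]
  have h0 := (hpos z).ne'
  have e0 : (Ev α δ β (n + 1) z fun _ => 1) = Ev α δ β (n + 1) z fun x => psum 1 x ^ 0 := by simp
  rw [e0]
  have hkp := twelve_mul_kpInt (ae_muz α δ z) hβ0 c (n + 1)
    (m := fun k => Ev α δ β (n + 1) z fun x => psum 1 x ^ k) (fun _ => rfl) rfl rfl rfl rfl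
  obtain ⟨r00, r01, r02, r10, r11⟩ :=
    moment_relations hα hδ hβ z n rfl rfl rfl rfl rfl rfl rfl rfl rfl rfl rfl
  change 12 * kpInt (muz α δ z) β c (n + 1) = _ + c ^ 2 * (3 * (_ * (Ev α δ β (n + 1) z
    fun x => psum 2 x ^ 2) - (Ev α δ β (n + 1) z (psum 2)) ^ 2) - 4 * (_ * (Ev α δ β (n + 1) z
    fun x => psum 1 x * psum 3 x) - _ * Ev α δ β (n + 1) z (psum 3))) at hkp
  rw [hkp]
  generalize (Ev α δ β (n + 1) z fun x => psum 1 x ^ 0) = m0 at *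
  generalize (Ev α δ β (n + 1) z fun x => psum 1 x ^ 1) = m1 at *
  generalize (Ev α δ β (n + 1) z fun x => psum 1 x ^ 2) = m2 at *
  generalize (Ev α δ β (n + 1) z fun x => psum 1 x ^ 3) = m3 at *
  generalize (Ev α δ β (n + 1) z fun x => psum 1 x ^ 4) = m4 at *
  generalize (Ev α δ β (n + 1) z (psum 2)) = P2 at *
  generalize (Ev α δ β (n + 1) z (psum 3)) = P3 at *
  generalize (Ev α δ β (n + 1) z fun x => psum 1 x * psum 2 x) = P12 at *
  generalize (Ev α δ β (n + 1) z fun x => psum 2 x ^ 2) = P22 at *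
  generalize (Ev α δ β (n + 1) z fun x => psum 1 x * psum 3 x) = P13 at *
  have key := loop_elimination (α := α) (β := β) (d := δ / 2) (z := z) (n := n) (m1 := m1 / m0)
    (m2 := m2 / m0) (m3 := m3 / m0) (P2 := P2 / m0) (P3 := P3 / m0) (P12 := P12 / m0)
    (P22 := P22 / m0) (P13 := P13 / m0) rfl rfl
    (by field_simp; linear_combination 2 * r00) (by field_simp; linear_combination 2 * r01)
    (by field_simp; linear_combination 2 * r02) (by field_simp; linear_combination 2 * r10)
    (by field_simp; linear_combination 2 * r11)
  have k2 : (m0 * m2 - m1 ^ 2) / m0 ^ 2 = m2 / m0 - (m1 / m0) ^ 2 := by field_simp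
  have k3 : (m3 * m0 ^ 2 - 3 * m0 * m1 * m2 + 2 * m1 ^ 3) / m0 ^ 3
      = m3 / m0 - 3 * (m1 / m0) * (m2 / m0) + 2 * (m1 / m0) ^ 3 := by field_simp
  have k4 : (m4 * m0 ^ 3 - 4 * m3 * m1 * m0 ^ 2 - 3 * m2 ^ 2 * m0 ^ 2 + 12 * m2 * m1 ^ 2 * m0
      - 6 * m1 ^ 4) / m0 ^ 4 = (m0 * m4 - 4 * (m1 * m3) + 3 * m2 ^ 2) / m0 ^ 2
        - 6 * (m2 / m0 - (m1 / m0) ^ 2) ^ 2 := by field_simp; ring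
  have kr : (c ^ 4 * (m0 * m4 - 4 * (m1 * m3) + 3 * m2 ^ 2) + c ^ 2 * (3 * (m0 * P22 - P2 ^ 2)
      - 4 * (m0 * P13 - m1 * P3))) / (c ^ 2 * m0 ^ 2)
      = c ^ 2 * ((m0 * m4 - 4 * (m1 * m3) + 3 * m2 ^ 2) / m0 ^ 2)
        + (3 * (P22 / m0 - (P2 / m0) ^ 2) - 4 * (P13 / m0 - m1 / m0 * (P3 / m0))) := by
    field_simp
  rw [k2, k3, k4, kr]
  linear_combination key

theorem exp_sigCond_ratio {α δ β : ℝ} (hα : -1 < α) (hδ : -2 < δ) (hβ : 0 ≤ β) (z : ℝ)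
    (a b n : ℕ) :
    cSel β α δ a * cSel β α δ b / cSel β α δ n ^ 2 *
      Real.exp (sigCond β α δ a z + sigCond β α δ b z - 2 * sigCond β α δ n z)
    = (Ev α δ β a z fun _ => 1) * (Ev α δ β b z fun _ => 1) / (Ev α δ β n z fun _ => 1) ^ 2 := by
  have h := fun m w => Ev_one_pos hα hδ hβ m w
  have hM : ∀ m, 0 < Mcond β α δ m z := fun m => by
    rw [Mcond_eq hα hδ]; exact div_pos (h m z) (h m 0)
  simp only [sigCond]
  rw [Real.exp_sub, Real.exp_add, Real.exp_log (hM a), Real.exp_log (hM b), two_mul, Real.exp_add,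
    Real.exp_log (hM n), Mcond_eq hα hδ, Mcond_eq hα hδ, Mcond_eq hα hδ, cSel_eq hα hδ,
    cSel_eq hα hδ, cSel_eq hα hδ]
  have ha := (h a 0).ne'
  have hb := (h b 0).ne'
  have hn := (h n 0).ne'
  have hnz := (h n z).ne'
  field_simp

/-- The nonlinear ODE satisfied by the cumulant generating function of the conductance,
for `β ∈ {1,2,4}`. -/
theorem conductance_cgf_ode
    (β α δ : ℝ) (hβ : β = 1 ∨ β = 2 ∨ β = 4) (hα : -1 < α) (hδ : -2 < δ)
    (n : ℕ) (hn : 1 ≤ n) (hn1 : β = 1 → 3 ≤ n) (hn4 : β = 4 → 2 ≤ n) :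
    (∀ m : ℕ, ContDiff ℝ (⊤ : ℕ∞) (sigCond β α δ m)) ∧
    ∀ z : ℝ,
      eta β * z ^ 3 * iteratedDeriv 4 (sigCond β α δ n) z
        + 6 * eta β * z ^ 3 * (iteratedDeriv 2 (sigCond β α δ n) z) ^ 2
        + β * (2 * z ^ 2 * iteratedDeriv 3 (sigCond β α δ n) z
            + z * (deriv (sigCond β α δ n) z) ^ 2
            + 4 * z ^ 2 * deriv (sigCond β α δ n) z * iteratedDeriv 2 (sigCond β α δ n) z)
        + ((-z ^ 3 + 2 * (β * n + α - δ / 2) * z ^ 2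
              - (β * n + α + δ / 2 + 6 - 3 * β) * (β * n + α + δ / 2 + 2 - β) * z + β * z) *
                iteratedDeriv 2 (sigCond β α δ n) z
            + ((β * n + α - δ / 2) * z
                - (β * n + α + δ / 2) * (β * n + α + δ / 2 + 2 - β)) *
                deriv (sigCond β α δ n) z
            + (-((n : ℝ) / 2) * (β * n + 2 * α + 2 - β) * (β * n + δ / 2 + α - z)))
      = (12 * bcoef β α δ n / β) * z ^ 3 *
          Real.exp (sigCond β α δ (n - ibeta β) z + sigCond β α δ (n + ibeta β) z
            - 2 * sigCond β α δ n z) := by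
  have hβ1 : 1 ≤ β := by rcases hβ with rfl | rfl | rfl <;> norm_num
  refine ⟨contDiff_sigCond hα hδ (by linarith), fun z => ?_⟩
  have := isFiniteMeasure_muz hα hδ z
  obtain ⟨n, rfl⟩ := Nat.exists_eq_add_of_le' hn
  rcases hβ with rfl | rfl | rfl
  · obtain ⟨n, rfl⟩ : ∃ l, n = l + 1 := ⟨n - 1, by have := hn1 rfl; omega⟩
    have h := cgf_ode_kpInt hα hδ le_rfl z (n + 1) one_ne_zero
    have hr := exp_sigCond_ratio hα hδ zero_le_one z n (n + 1 + 1 + 2) (n + 1 + 1)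
    have hk := kpInt_one (ae_muz α δ z) n
    have ht : ∀ m, ∫ x, vand 1 x ∂(powM (muz α δ z) m) = Ev α δ 1 m z fun _ => 1 := fun m => by
      simp [Ev]
    rw [ht, ht] at hk
    have he : eta 1 = 1 := by norm_num [eta]
    have hi : ibeta 1 = 2 := by norm_num [ibeta]
    have hb : bcoef 1 α δ (n + 1 + 1) = (n + 1) * (n + 2) / ((n + 3) * (n + 4)) *
        (cSel 1 α δ n * cSel 1 α δ (n + 1 + 1 + 2) / cSel 1 α δ (n + 1 + 1) ^ 2) := by
      rw [bcoef, if_pos rfl, Nat.add_sub_cancel n 2]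
      push_cast
      ring
    rw [he, hi, hb, Nat.add_sub_cancel n 2]
    have hp := (Ev_one_pos hα hδ zero_le_one (n + 1 + 1) z).ne'
    have hk' : kpInt (muz α δ z) 1 1 (n + 2) = (n + 1) * (n + 2) / ((n + 3) * (n + 4)) *
        ((Ev α δ 1 n z fun _ => 1) * Ev α δ 1 (n + 1 + 1 + 2) z fun _ => 1) := by
      field_simp
      linear_combination hk
    rw [hk'] at h
    push_cast at h ⊢
    linear_combination h - 12 * z ^ 3 * ((n + 1) * (n + 2) / ((n + 3) * (n + 4))) * hr
  · have h := cgf_ode_kpInt hα hδ one_le_two z n one_ne_zero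
    have he : eta 2 = 1 := by norm_num [eta]
    have hb : bcoef 2 α δ (n + 1) = 0 := by norm_num [bcoef]
    rw [he, hb]
    rw [kpInt_two (ae_muz α δ z)] at h
    push_cast
    linear_combination h
  · have h := cgf_ode_kpInt hα hδ (by norm_num) z n two_ne_zero (β := 4)
    have hr := exp_sigCond_ratio hα hδ zero_le_four z n (n + 1 + 1) (n + 1)
    have hk := kpInt_four (ae_muz α δ z) n
    have ht : ∀ m, ∫ x, vand 4 x ∂(powM (muz α δ z) m) = Ev α δ 4 m z fun _ => 1 := fun m => by
      simp [Ev]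
    rw [ht, ht] at hk
    have he : eta 4 = 4 := by norm_num [eta]
    have hi : ibeta 4 = 1 := by norm_num [ibeta]
    have hb : bcoef 4 α δ (n + 1) = (n + 1) / (n + 2) *
        (cSel 4 α δ n * cSel 4 α δ (n + 1 + 1) / cSel 4 α δ (n + 1) ^ 2) := by
      rw [bcoef, if_neg (by norm_num), if_pos rfl, Nat.add_sub_cancel n 1]
      push_cast
      ring
    rw [he, hi, hb, Nat.add_sub_cancel n 1]
    have hk' : kpInt (muz α δ z) 4 2 (n + 1) = (n + 1) / (n + 2) *
        ((Ev α δ 4 n z fun _ => 1) * Ev α δ 4 (n + 1 + 1) z fun _ => 1) := by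
      field_simp
      linear_combination hk
    rw [hk'] at h
    push_cast at h ⊢
    linear_combination h - 3 * z ^ 3 * ((n + 1) / (n + 2)) * hr
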